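/- arXiv:0803.1740 — 2 statements merged into one kernel-verified Lean document; each statement's English description precedes it below -/
import Mathlib

section
/- Let β be a real number. Then for almost all (in the sense of Lebesgue measure) real numbers α > 0, one has limsup_{x→∞} π*_{α,β}(x)·(log x)²/x ≥ 1. -/
open MeasureTheory Filter

/-- `piStar α β x` counts the primes `p ≤ x` such that `⌊α p + β⌋` is also prime. -/
noncomputable def piStar (α β x : ℝ) : ℕ :=
  {p : ℕ | p.Prime ∧ (p : ℝ) ≤ x ∧ Nat.Prime (⌊α * p + β⌋).toNat}.ncard

open scoped Chebyshev in
/-- The Laplace transform of `ψ (exp t) / exp t`, in terms of the L-series of `Λ`. -/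
theorem integral_psi_exp_mul_exp_neg {s : ℂ} (hs : 0 < s.re) :
    ∫ t in Set.Ioi (0 : ℝ), ((ψ (Real.exp t) * Real.exp (-t) : ℝ) : ℂ) * Complex.exp (-s * t) =
      LSeries (fun n => (ArithmeticFunction.vonMangoldt n : ℂ)) (1 + s) / (1 + s) := by
  have hs1 : (1 + s) ≠ 0 := by
    intro h
    have := congrArg Complex.re h
    simp at this; linarith
  have hO : (fun n : ℕ => ∑ k ∈ Finset.Icc 1 n, ArithmeticFunction.vonMangoldt k) =O[atTop]
      fun n => (n : ℝ) ^ (1 : ℝ) := by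
    refine Asymptotics.IsBigO.of_bound (Real.log 4 + 4) (Eventually.of_forall fun n => ?_)
    have h := Chebyshev.psi_le_const_mul_self (Nat.cast_nonneg (α := ℝ) n)
    rw [Real.norm_of_nonneg (Finset.sum_nonneg fun _ _ =>
      ArithmeticFunction.vonMangoldt_nonneg), Real.rpow_one, Real.norm_natCast]
    rw [Chebyshev.psi, Nat.floor_natCast] at h
    exact h
  have key := LSeries_eq_mul_integral_of_nonneg (s := 1 + s)
    (fun n => ArithmeticFunction.vonMangoldt n) zero_le_one (by simpa using hs) hO
    (fun _ => ArithmeticFunction.vonMangoldt_nonneg)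
  rw [key, mul_div_cancel_left₀ _ hs1, ← Real.exp_zero, ← integral_comp_exp_Ioi]
  refine setIntegral_congr_fun measurableSet_Ioi fun t _ => ?_
  have h1 : (∑ k ∈ Finset.Icc 1 ⌊Real.exp t⌋₊, (ArithmeticFunction.vonMangoldt k : ℂ)) =
      (ψ (Real.exp t) : ℂ) := by
    simp only [Chebyshev.psi]; push_cast; rfl
  simp only [h1, Complex.real_smul, Complex.ofReal_mul, Complex.ofReal_exp]
  have h2 : Complex.log (Complex.exp t) = t := by
    rw [← Complex.ofReal_exp, ← Complex.ofReal_log (Real.exp_pos t).le, Real.log_exp]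
  rw [Complex.cpow_def_of_ne_zero (Complex.exp_ne_zero _), h2, mul_left_comm,
    mul_assoc, ← Complex.exp_add, ← Complex.exp_add]
  congr 2
  push_cast
  ring

theorem integrableOn_Ioi_exp_neg_mul {s : ℂ} (hs : 0 < s.re) :
    IntegrableOn (fun t : ℝ => Complex.exp (-s * t)) (Set.Ioi 0) := by
  simpa using! integrableOn_exp_mul_complex_Ioi (a := -s) (by simpa using hs) 0

/-- The Laplace transform of `ψ (exp t) / exp t - 1` extends continuously to the closed right
half plane. -/
theorem exists_continuousOn_laplace_psi : ∃ G : ℂ → ℂ, ContinuousOn G {s | 0 ≤ s.re} ∧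
    ∀ s : ℂ, 0 < s.re →
      ∫ t in Set.Ioi (0 : ℝ), ((Chebyshev.psi (Real.exp t) * Real.exp (-t) - 1 : ℝ) : ℂ) *
        Complex.exp (-s * t) = G s := by
  have hc := ArithmeticFunction.vonMangoldt.continuousOn_LFunctionResidueClassAux (1 : ZMod 1)
  have he := ArithmeticFunction.vonMangoldt.eqOn_LFunctionResidueClassAux (a := (1 : ZMod 1))
    isUnit_one
  set H := ArithmeticFunction.vonMangoldt.LFunctionResidueClassAux (1 : ZMod 1)
  have hne : ∀ s : ℂ, 0 ≤ s.re → 1 + s ≠ 0 := by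
    intro s hs h
    have := congrArg Complex.re h
    simp at this; linarith
  refine ⟨fun s => (H (1 + s) - 1) / (1 + s), ?_, fun s hs => ?_⟩
  · refine ContinuousOn.div (ContinuousOn.sub (hc.comp (by fun_prop) fun s hs => ?_)
      continuousOn_const) (by fun_prop) hne
    simpa using hs
  · have hs0 : s ≠ 0 := by rintro rfl; simp at hs
    have h1 := integral_psi_exp_mul_exp_neg hs
    have h2 : ∫ t in Set.Ioi (0 : ℝ), Complex.exp (-s * t) = 1 / s := by
      have := integral_exp_mul_complex_Ioi (a := -s) (by simpa using hs) 0
      rw [this]; simp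
    have h3 := he (x := 1 + s) (by simpa using hs)
    have h4 : (fun n : ℕ => (ArithmeticFunction.vonMangoldt.residueClass (1 : ZMod 1) n : ℂ)) =
        fun n => (ArithmeticFunction.vonMangoldt n : ℂ) := by
      ext n
      simp [ArithmeticFunction.vonMangoldt.residueClass, Set.indicator,
        Subsingleton.elim (n : ZMod 1) 1]
    simp only [h4, Nat.totient_one] at h3
    have hmeas : Measurable fun t : ℝ => Chebyshev.psi (Real.exp t) * Real.exp (-t) :=
      (Chebyshev.psi_mono.measurable.comp Real.measurable_exp).mul (by fun_prop)
    have hintg : IntegrableOn (fun t : ℝ =>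
        ((Chebyshev.psi (Real.exp t) * Real.exp (-t) : ℝ) : ℂ) * Complex.exp (-s * t))
        (Set.Ioi 0) := by
      refine (integrableOn_Ioi_exp_neg_mul hs).bdd_mul (c := Real.log 4 + 4)
        hmeas.complex_ofReal.aestronglyMeasurable (Eventually.of_forall fun t => ?_)
      rw [Complex.norm_real, Real.norm_of_nonneg
        (mul_nonneg (Chebyshev.psi_nonneg _) (Real.exp_pos _).le)]
      have h := Chebyshev.psi_le_const_mul_self (Real.exp_pos t).le
      calc _ ≤ (Real.log 4 + 4) * Real.exp t * Real.exp (-t) := by gcongr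
        _ = _ := by rw [mul_assoc, ← Real.exp_add]; simp
    simp only [Complex.ofReal_sub, sub_mul, Complex.ofReal_one, one_mul]
    rw [integral_sub hintg (integrableOn_Ioi_exp_neg_mul hs), h1, h2, h3]
    have := hne s hs.le
    simp only [Nat.cast_one, inv_one, add_sub_cancel_left]
    field_simp
    ring

/-- The Fejér kernel whose Fourier transform is supported in `[-l, l]`. -/
noncomputable def fejerKernel (l u : ℝ) : ℝ := 2 * ∫ τ in (0 : ℝ)..l, (l - τ) * Real.cos (τ * u)

theorem fejerKernel_eq (l : ℝ) {u : ℝ} (hu : u ≠ 0) :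
    fejerKernel l u = 2 * (1 - Real.cos (l * u)) / u ^ 2 := by
  have h : ∀ τ ∈ Set.uIcc 0 l, HasDerivAt
      (fun τ => (l - τ) * (Real.sin (τ * u) / u) - Real.cos (τ * u) / u ^ 2)
      ((l - τ) * Real.cos (τ * u)) τ := by
    intro τ _
    have h1 : HasDerivAt (fun τ : ℝ => τ * u) u τ := by simpa using (hasDerivAt_id τ).mul_const u
    have h2 := ((hasDerivAt_id τ).const_sub l).mul (h1.sin.div_const u)
    have h3 := h2.sub (h1.cos.div_const (u ^ 2))
    refine h3.congr_deriv ?_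
    simp only [id]
    field_simp
    ring
  rw [fejerKernel, intervalIntegral.integral_eq_sub_of_hasDerivAt h
    (Continuous.intervalIntegrable (by fun_prop) _ _)]
  simp
  ring

theorem fejerKernel_zero (l : ℝ) : fejerKernel l 0 = l ^ 2 := by
  have h : ∫ τ in (0 : ℝ)..l, (l - τ) = l ^ 2 / 2 := by
    rw [intervalIntegral.integral_sub (by simp) (by simp)]
    simp
    ring
  simp only [fejerKernel, mul_zero, Real.cos_zero, mul_one, h]
  ring

theorem fejerKernel_nonneg (l u : ℝ) : 0 ≤ fejerKernel l u := by
  rcases eq_or_ne u 0 with rfl | hu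
  · rw [fejerKernel_zero]; positivity
  · rw [fejerKernel_eq l hu]
    have := Real.cos_le_one (l * u)
    have : 0 ≤ 1 - Real.cos (l * u) := by linarith
    positivity

theorem fejerKernel_le_div_sq (l : ℝ) {u : ℝ} (hu : u ≠ 0) : fejerKernel l u ≤ 4 / u ^ 2 := by
  rw [fejerKernel_eq l hu]
  have := Real.neg_one_le_cos (l * u)
  gcongr
  linarith

theorem fejerKernel_le_sq (l u : ℝ) : fejerKernel l u ≤ l ^ 2 := by
  rcases eq_or_ne u 0 with rfl | hu
  · rw [fejerKernel_zero]
  · rw [fejerKernel_eq l hu, div_le_iff₀ (by positivity)]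
    have := Real.one_sub_sq_div_two_le_cos (x := l * u)
    nlinarith

theorem fejerKernel_le (l u : ℝ) : fejerKernel l u ≤ (l ^ 2 + 4) * (1 + u ^ 2)⁻¹ := by
  rw [← div_eq_mul_inv, le_div_iff₀ (by positivity), mul_add, mul_one]
  refine add_le_add (fejerKernel_le_sq l u) ?_
  rcases eq_or_ne u 0 with rfl | hu
  · simp
  · exact (le_div_iff₀ (by positivity)).1 (fejerKernel_le_div_sq l hu)

theorem fejerKernel_scale (l u : ℝ) : fejerKernel l u = l ^ 2 * fejerKernel 1 (l * u) := by
  rcases eq_or_ne l 0 with rfl | hl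
  · simp [fejerKernel]
  rcases eq_or_ne u 0 with rfl | hu
  · simp [fejerKernel_zero]
  · rw [fejerKernel_eq l hu, fejerKernel_eq 1 (mul_ne_zero hl hu)]
    field_simp

theorem continuous_fejerKernel (l : ℝ) : Continuous (fejerKernel l) := by
  unfold fejerKernel
  refine continuous_const.mul ?_
  exact intervalIntegral.continuous_parametric_intervalIntegral_of_continuous'
    (f := fun u τ => (l - τ) * Real.cos (τ * u)) (by fun_prop) 0 l

theorem integrable_fejerKernel (l : ℝ) : Integrable (fejerKernel l) := by
  refine (integrable_inv_one_add_sq.const_mul (l ^ 2 + 4)).mono'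
    (continuous_fejerKernel l).aestronglyMeasurable (Eventually.of_forall fun u => ?_)
  rw [Real.norm_of_nonneg (fejerKernel_nonneg l u)]
  exact fejerKernel_le l u

theorem integral_fejerKernel_one_pos : 0 < ∫ u, fejerKernel 1 u := by
  rw [integral_pos_iff_support_of_nonneg (fejerKernel_nonneg 1) (integrable_fejerKernel 1)]
  refine (continuous_fejerKernel 1).isOpen_support.measure_pos _ ⟨0, ?_⟩
  simp [fejerKernel_zero]

theorem integral_fejerKernel {l : ℝ} (hl : 0 < l) :
    ∫ u, fejerKernel l u = l * ∫ u, fejerKernel 1 u := by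
  simp_rw [fejerKernel_scale l, integral_const_mul, Measure.integral_comp_mul_left]
  rw [abs_of_pos (inv_pos.2 hl), smul_eq_mul]
  field_simp

theorem re_integral_exp_eq_fejerKernel (l u : ℝ) :
    (∫ τ in (0 : ℝ)..l, (2 * (l - τ) : ℂ) * Complex.exp (τ * u * Complex.I)).re =
      fejerKernel l u := by
  have h : ∀ τ : ℝ, ((2 * (l - τ) : ℂ) * Complex.exp (τ * u * Complex.I)).re =
      2 * ((l - τ) * Real.cos (τ * u)) := by
    intro τ
    rw [← Complex.ofReal_mul τ u, ← Complex.ofReal_sub,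
      show (2 : ℂ) * ((l - τ : ℝ) : ℂ) = ((2 * (l - τ) : ℝ) : ℂ) by push_cast; ring,
      Complex.re_ofReal_mul, Complex.exp_ofReal_mul_I_re]
    ring
  have hintg : IntervalIntegrable (fun τ : ℝ => (2 * (l - τ) : ℂ) *
    Complex.exp (τ * u * Complex.I)) volume 0 l :=
      Continuous.intervalIntegrable (by fun_prop) _ _
  have h2 := Complex.reCLM.intervalIntegral_comp_comm hintg
  rw [Complex.reCLM_apply] at h2
  rw [← h2, fejerKernel, ← intervalIntegral.integral_const_mul]
  exact intervalIntegral.integral_congr fun τ _ => h τ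

section Tauberian

variable {f : ℝ → ℝ} {M : ℝ} {G : ℂ → ℂ}

theorem integral_mul_exp_mul_fejerKernel (hf : Measurable f) (hM : ∀ t, |f t| ≤ M)
    (hfG : ∀ s : ℂ, 0 < s.re →
      ∫ t in Set.Ioi (0 : ℝ), (f t : ℂ) * Complex.exp (-s * t) = G s)
    {l : ℝ} (hl : 0 < l) {σ : ℝ} (hσ : 0 < σ) (y : ℝ) :
    ∫ t in Set.Ioi (0 : ℝ), f t * Real.exp (-σ * t) * fejerKernel l (y - t) =
      (∫ τ in (0 : ℝ)..l, (2 * (l - τ) : ℂ) * Complex.exp (τ * y * Complex.I) *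
        G (σ + τ * Complex.I)).re := by
  let F : ℝ → ℝ → ℂ := fun t τ => ((f t * Real.exp (-σ * t) : ℝ) : ℂ) *
    ((2 * (l - τ) : ℂ) * Complex.exp (τ * (y - t : ℝ) * Complex.I))
  have hF : Integrable (Function.uncurry F)
      ((volume.restrict (Set.Ioi 0)).prod (volume.restrict (Set.Ioc 0 l))) := by
    have hb : Integrable (fun z : ℝ × ℝ => (M * Real.exp (-σ * z.1)) * (2 * l))
        ((volume.restrict (Set.Ioi 0)).prod (volume.restrict (Set.Ioc 0 l))) :=
      Integrable.mul_prod ((integrableOn_exp_mul_Ioi (by linarith) 0).const_mul M)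
        (integrable_const (2 * l))
    refine hb.mono' ?_ ?_
    · refine Measurable.aestronglyMeasurable ?_
      simp only [F, Function.uncurry_def]
      fun_prop
    · have h1 : ∀ᵐ z : ℝ × ℝ ∂((volume.restrict (Set.Ioi 0)).prod
          (volume.restrict (Set.Ioc 0 l))), z ∈ Set.Ioi 0 ×ˢ Set.Ioc 0 l := by
        rw [Measure.prod_restrict]
        exact ae_restrict_mem (measurableSet_Ioi.prod measurableSet_Ioc)
      filter_upwards [h1] with z hz
      have hτ := hz.2
      simp only [F, Function.uncurry_def]
      rw [norm_mul, norm_mul, ← Complex.ofReal_mul z.2, Complex.norm_exp_ofReal_mul_I, mul_one,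
        ← Complex.ofReal_sub,
        show (2 : ℂ) * ((l - z.2 : ℝ) : ℂ) = ((2 * (l - z.2) : ℝ) : ℂ) by push_cast; ring,
        Complex.norm_real, Complex.norm_real, Real.norm_eq_abs, Real.norm_eq_abs, abs_mul,
        abs_of_pos (Real.exp_pos _), abs_of_nonneg (by linarith [hτ.2] : 0 ≤ 2 * (l - z.2))]
      have := hτ.1
      have hM0 : 0 ≤ M := (abs_nonneg (f 0)).trans (hM 0)
      exact mul_le_mul (mul_le_mul_of_nonneg_right (hM z.1) (Real.exp_pos _).le) (by linarith)
        (by linarith [hτ.2]) (by positivity)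
  have hswap := integral_integral_swap hF
  have hL : ∀ t, ∫ τ in Set.Ioc 0 l, F t τ = ((f t * Real.exp (-σ * t) : ℝ) : ℂ) *
      ∫ τ in (0 : ℝ)..l, (2 * (l - τ) : ℂ) * Complex.exp (τ * (y - t : ℝ) * Complex.I) := by
    intro t
    rw [intervalIntegral.integral_of_le hl.le, ← integral_const_mul]
  have hR : ∀ τ, ∫ t in Set.Ioi 0, F t τ = (2 * (l - τ) : ℂ) *
      Complex.exp (τ * y * Complex.I) * G (σ + τ * Complex.I) := by
    intro τ
    rw [← hfG (σ + τ * Complex.I) (by simpa using hσ), ← integral_const_mul]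
    congr 1 with t
    have : Complex.exp (-(σ + τ * Complex.I) * t) =
        Complex.exp (-σ * t) * Complex.exp (-τ * t * Complex.I) := by
      rw [← Complex.exp_add]; congr 1; ring
    have h2 : Complex.exp (τ * (y - t : ℝ) * Complex.I) =
        Complex.exp (τ * y * Complex.I) * Complex.exp (-τ * t * Complex.I) := by
      rw [← Complex.exp_add]; congr 1; push_cast; ring
    simp only [F, this, h2]
    push_cast
    ring
  simp_rw [hL, hR] at hswap
  rw [intervalIntegral.integral_of_le hl.le, ← hswap]
  have hintg := hF.integral_prod_left
  simp only [Function.uncurry_def, hL] at hintg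
  have hre := Complex.reCLM.integral_comp_comm hintg
  rw [Complex.reCLM_apply] at hre
  rw [← hre]
  congr 1 with t
  rw [Complex.reCLM_apply, Complex.re_ofReal_mul, re_integral_exp_eq_fejerKernel]

theorem integral_mul_fejerKernel (hf : Measurable f) (hM : ∀ t, |f t| ≤ M)
    (hG : ContinuousOn G {s | 0 ≤ s.re})
    (hfG : ∀ s : ℂ, 0 < s.re →
      ∫ t in Set.Ioi (0 : ℝ), (f t : ℂ) * Complex.exp (-s * t) = G s)
    {l : ℝ} (hl : 0 < l) (y : ℝ) :
    ∫ t in Set.Ioi (0 : ℝ), f t * fejerKernel l (y - t) =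
      (∫ τ in (0 : ℝ)..l, (2 * (l - τ) : ℂ) * Complex.exp (τ * y * Complex.I) *
        G (τ * Complex.I)).re := by
  have hk : Integrable (fun t => fejerKernel l (y - t)) :=
    (integrable_fejerKernel l).comp_sub_left y
  have hkm : Measurable fun t => fejerKernel l (y - t) :=
    ((continuous_fejerKernel l).comp (by fun_prop)).measurable
  have hlim1 : Tendsto (fun σ : ℝ => ∫ t in Set.Ioi (0 : ℝ),
      f t * Real.exp (-σ * t) * fejerKernel l (y - t)) (nhdsWithin 0 (Set.Ioi 0))
      (nhds (∫ t in Set.Ioi (0 : ℝ), f t * fejerKernel l (y - t))) := by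
    refine tendsto_integral_filter_of_dominated_convergence
      (fun t => M * fejerKernel l (y - t)) ?_ ?_ (hk.const_mul M).integrableOn ?_
    · refine Eventually.of_forall fun σ => Measurable.aestronglyMeasurable ?_
      fun_prop
    · filter_upwards [self_mem_nhdsWithin] with σ hσ
      filter_upwards [ae_restrict_mem measurableSet_Ioi] with t ht
      rw [Real.norm_eq_abs, abs_mul, abs_mul, abs_of_nonneg (fejerKernel_nonneg _ _),
        abs_of_pos (Real.exp_pos _)]
      have h1 : Real.exp (-σ * t) ≤ 1 := by
        rw [Real.exp_le_one_iff]
        have := mul_pos (Set.mem_Ioi.1 hσ) (Set.mem_Ioi.1 ht)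
        linarith
      have h2 := hM t
      refine mul_le_mul_of_nonneg_right ?_ (fejerKernel_nonneg _ _)
      nlinarith [abs_nonneg (f t)]
    · refine Eventually.of_forall fun t => ?_
      have : Tendsto (fun σ : ℝ => f t * Real.exp (-σ * t) * fejerKernel l (y - t)) (nhds 0)
          (nhds (f t * Real.exp (-0 * t) * fejerKernel l (y - t))) :=
        Continuous.tendsto (by fun_prop) 0
      simpa using this.mono_left nhdsWithin_le_nhds
  have hcont : ContinuousOn (fun z : ℝ × ℝ => G (z.1 + z.2 * Complex.I))
      (Set.Icc 0 1 ×ˢ Set.Icc 0 l) := by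
    refine hG.comp (by fun_prop) fun z hz => ?_
    simpa using hz.1.1
  obtain ⟨C, hC⟩ := (isCompact_Icc.prod isCompact_Icc).exists_bound_of_continuousOn hcont
  have hlim2 : Tendsto (fun σ : ℝ => ∫ τ in (0 : ℝ)..l, (2 * (l - τ) : ℂ) *
      Complex.exp (τ * y * Complex.I) * G (σ + τ * Complex.I)) (nhdsWithin 0 (Set.Ioi 0))
      (nhds (∫ τ in (0 : ℝ)..l, (2 * (l - τ) : ℂ) *
        Complex.exp (τ * y * Complex.I) * G (τ * Complex.I))) := by
    have hmem : ∀ᶠ σ : ℝ in nhdsWithin 0 (Set.Ioi 0), σ ∈ Set.Ioc (0 : ℝ) 1 :=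
      Ioc_mem_nhdsGT one_pos
    refine intervalIntegral.tendsto_integral_filter_of_dominated_convergence
      (fun τ => 2 * l * C) ?_ ?_ (by simp) ?_
    · filter_upwards [hmem] with σ hσ
      rw [Set.uIoc_of_le hl.le]
      refine ContinuousOn.aestronglyMeasurable ?_ measurableSet_Ioc
      refine ContinuousOn.mul (by fun_prop) (hG.comp (by fun_prop) fun τ _ => ?_)
      simpa using hσ.1.le
    · filter_upwards [hmem] with σ hσ
      refine Eventually.of_forall fun τ hτ => ?_
      rw [Set.uIoc_of_le hl.le] at hτ
      have h1 := hC (σ, τ) ⟨⟨hσ.1.le, hσ.2⟩, hτ.1.le, hτ.2⟩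
      rw [norm_mul, norm_mul, ← Complex.ofReal_mul τ, Complex.norm_exp_ofReal_mul_I, mul_one,
        ← Complex.ofReal_sub,
        show (2 : ℂ) * ((l - τ : ℝ) : ℂ) = ((2 * (l - τ) : ℝ) : ℂ) by push_cast; ring,
        Complex.norm_real, Real.norm_eq_abs,
        abs_of_nonneg (by linarith [hτ.2] : 0 ≤ 2 * (l - τ))]
      have := hτ.1
      gcongr
      · linarith
    · refine Eventually.of_forall fun τ hτ => ?_
      rw [Set.uIoc_of_le hl.le] at hτ
      refine Tendsto.mul tendsto_const_nhds ?_
      have h1 : ContinuousWithinAt (fun σ : ℝ => G (σ + τ * Complex.I)) (Set.Ici 0) 0 := by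
        refine (hG.comp (f := fun σ : ℝ => (σ + τ * Complex.I : ℂ)) (s := Set.Ici 0)
          (by fun_prop) fun σ hσ => ?_) 0 (by simp)
        simpa using hσ
      have h2 := h1.tendsto.mono_left (nhdsWithin_mono _ Set.Ioi_subset_Ici_self)
      simpa using h2
  have hre := (Complex.continuous_re.tendsto _).comp hlim2
  refine tendsto_nhds_unique hlim1 (hre.congr' ?_)
  filter_upwards [self_mem_nhdsWithin] with σ hσ
  exact (integral_mul_exp_mul_fejerKernel hf hM hfG hl hσ y).symm

theorem tendsto_integral_mul_fejerKernel (hf : Measurable f) (hM : ∀ t, |f t| ≤ M)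
    (hG : ContinuousOn G {s | 0 ≤ s.re})
    (hfG : ∀ s : ℂ, 0 < s.re →
      ∫ t in Set.Ioi (0 : ℝ), (f t : ℂ) * Complex.exp (-s * t) = G s)
    {l : ℝ} (hl : 0 < l) :
    Tendsto (fun y => ∫ t in Set.Ioi (0 : ℝ), f t * fejerKernel l (y - t)) atTop (nhds 0) := by
  have h := Real.tendsto_integral_exp_smul_cocompact
    ((Set.Ioc 0 l).indicator fun τ : ℝ => (2 * (l - τ) : ℂ) * G (τ * Complex.I))
  have hy : Tendsto (fun y : ℝ => -(2 * Real.pi)⁻¹ * y) atTop (cocompact ℝ) := by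
    refine Tendsto.mono_right ?_ atBot_le_cocompact
    exact tendsto_id.const_mul_atTop_of_neg (by simp [Real.pi_pos])
  have h2 := (Complex.continuous_re.tendsto _).comp (h.comp hy)
  rw [Complex.zero_re] at h2
  refine h2.congr fun y => ?_
  rw [integral_mul_fejerKernel hf hM hG hfG hl y, Function.comp_apply, Function.comp_apply,
    intervalIntegral.integral_of_le hl.le, ← integral_indicator measurableSet_Ioc]
  congr 2 with τ
  by_cases hτ : τ ∈ Set.Ioc 0 l
  · simp only [Set.indicator_of_mem hτ, Circle.smul_def, Real.fourierChar_apply, smul_eq_mul]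
    rw [show 2 * Real.pi * -(τ * (-(2 * Real.pi)⁻¹ * y)) = τ * y by field_simp]
    push_cast
    ring
  · simp [Set.indicator_of_notMem hτ]

end Tauberian

section PNT

theorem fejerKernel_neg (l u : ℝ) : fejerKernel l (-u) = fejerKernel l u := by
  simp [fejerKernel]

theorem setIntegral_Ioi_fejerKernel_le (l : ℝ) {h : ℝ} (hh : 0 < h) :
    ∫ u in Set.Ioi h, fejerKernel l u ≤ 4 / h := by
  have h1 : ∫ u in Set.Ioi h, 4 * u ^ (-2 : ℝ) = 4 / h := by
    rw [integral_const_mul, integral_Ioi_rpow_of_lt (by norm_num) hh,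
      show (-2 : ℝ) + 1 = -1 by norm_num, Real.rpow_neg_one]
    field_simp
  rw [← h1]
  refine setIntegral_mono_on (integrable_fejerKernel l).integrableOn
    ((integrableOn_Ioi_rpow_of_lt (by norm_num) hh).const_mul 4) measurableSet_Ioi fun u hu => ?_
  have hu0 : 0 < u := hh.trans hu
  rw [Real.rpow_neg hu0.le, Real.rpow_two, ← div_eq_mul_inv]
  exact fejerKernel_le_div_sq l hu0.ne'

theorem setIntegral_compl_Icc_fejerKernel_le (l : ℝ) {h : ℝ} (hh : 0 < h) :
    ∫ u in (Set.Icc (-h) h)ᶜ, fejerKernel l u ≤ 8 / h := by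
  have h1 := setIntegral_Ioi_fejerKernel_le l hh
  have h2 : ∫ u in Set.Iio (-h), fejerKernel l u ≤ 4 / h := by
    rw [← integral_Iic_eq_integral_Iio, ← integral_comp_neg_Ioi]
    simpa only [fejerKernel_neg] using h1
  have h3 : (Set.Icc (-h) h)ᶜ = Set.Iio (-h) ∪ Set.Ioi h := by
    ext u
    simp only [Set.mem_compl_iff, Set.mem_Icc, not_and_or, not_le, Set.mem_union, Set.mem_Iio,
      Set.mem_Ioi]
  rw [h3, setIntegral_union (Set.disjoint_left.2 fun u hu hu' => by
      simp only [Set.mem_Iio, Set.mem_Ioi] at *; linarith) measurableSet_Ioi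
    (integrable_fejerKernel l).integrableOn (integrable_fejerKernel l).integrableOn]
  calc _ ≤ 4 / h + 4 / h := add_le_add h2 h1
    _ = 8 / h := by ring

theorem measurable_psi_exp_mul_exp_neg :
    Measurable fun t : ℝ => Chebyshev.psi (Real.exp t) * Real.exp (-t) :=
  (Chebyshev.psi_mono.measurable.comp Real.measurable_exp).mul (by fun_prop)

theorem psi_exp_mul_exp_neg_nonneg (t : ℝ) :
    0 ≤ Chebyshev.psi (Real.exp t) * Real.exp (-t) :=
  mul_nonneg (Chebyshev.psi_nonneg _) (Real.exp_pos _).le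

theorem psi_exp_mul_exp_neg_le (t : ℝ) :
    Chebyshev.psi (Real.exp t) * Real.exp (-t) ≤ Real.log 4 + 4 := by
  have h := Chebyshev.psi_le_const_mul_self (Real.exp_pos t).le
  calc _ ≤ (Real.log 4 + 4) * Real.exp t * Real.exp (-t) := by gcongr
    _ = _ := by rw [mul_assoc, ← Real.exp_add]; simp

theorem psi_exp_mul_exp_neg_le_mul {s t : ℝ} (hst : s ≤ t) :
    Chebyshev.psi (Real.exp s) * Real.exp (-s) ≤
      Real.exp (t - s) * (Chebyshev.psi (Real.exp t) * Real.exp (-t)) := by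
  have h1 : Real.exp (-s) = Real.exp (t - s) * Real.exp (-t) := by
    rw [← Real.exp_add]; congr 1; ring
  have h2 := Chebyshev.psi_mono (Real.exp_le_exp.2 hst)
  rw [h1, mul_left_comm]
  gcongr

theorem integrable_psi_exp_mul_fejerKernel (l y : ℝ) :
    Integrable fun u =>
      Chebyshev.psi (Real.exp (y - u)) * Real.exp (-(y - u)) * fejerKernel l u := by
  refine (integrable_fejerKernel l).bdd_mul (c := Real.log 4 + 4)
    (measurable_psi_exp_mul_exp_neg.comp (by fun_prop)).aestronglyMeasurable
    (Eventually.of_forall fun u => ?_)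
  rw [Real.norm_of_nonneg (psi_exp_mul_exp_neg_nonneg _)]
  exact psi_exp_mul_exp_neg_le _

theorem tendsto_integral_psi_exp_mul_fejerKernel {l : ℝ} (hl : 0 < l) :
    Tendsto (fun y => ∫ u, Chebyshev.psi (Real.exp (y - u)) * Real.exp (-(y - u)) *
      fejerKernel l u) atTop (nhds (∫ u, fejerKernel l u)) := by
  obtain ⟨G, hG, hfG⟩ := exists_continuousOn_laplace_psi
  have hlim := tendsto_integral_mul_fejerKernel (M := Real.log 4 + 4 + 1)
    (measurable_psi_exp_mul_exp_neg.sub_const 1) (fun t => by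
      rw [abs_le]
      have h0 := psi_exp_mul_exp_neg_nonneg t
      have h1 := psi_exp_mul_exp_neg_le t
      have : 0 ≤ Real.log 4 := Real.log_nonneg (by norm_num)
      constructor <;> linarith) hG hfG hl
  have hlim2 : Tendsto (fun y => ∫ u in Set.Iio y, fejerKernel l u) atTop
      (nhds (∫ u, fejerKernel l u)) :=
    (aecover_Iio tendsto_id).integral_tendsto_of_countably_generated (integrable_fejerKernel l)
  have := hlim.add hlim2
  rw [zero_add] at this
  refine this.congr fun y => ?_
  rw [← integral_indicator measurableSet_Ioi, ← integral_indicator measurableSet_Iio,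
    ← integral_sub_left_eq_self _ volume y, ← integral_add]
  · congr 1 with u
    by_cases hu : u < y
    · rw [Set.indicator_of_mem (show y - u ∈ Set.Ioi 0 by simpa using hu),
        Set.indicator_of_mem (show u ∈ Set.Iio y from hu), sub_sub_cancel]
      ring
    · rw [Set.indicator_of_notMem (show y - u ∉ Set.Ioi 0 by simpa using hu),
        Set.indicator_of_notMem (show u ∉ Set.Iio y from hu),
        Chebyshev.psi_eq_zero_of_le_one (Real.exp_le_one_iff.2 (by linarith [not_lt.1 hu]))]
      ring
  · have h1 : Integrable (fun u =>
        (Chebyshev.psi (Real.exp (y - u)) * Real.exp (-(y - u)) - 1) * fejerKernel l u) := by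
      simp_rw [sub_mul, one_mul]
      exact (integrable_psi_exp_mul_fejerKernel l y).sub (integrable_fejerKernel l)
    refine (h1.indicator (measurableSet_Iio (a := y))).congr (Eventually.of_forall fun u => ?_)
    by_cases hu : u < y
    · simp [Set.indicator, hu]
    · simp [Set.indicator, hu]
  · exact (integrable_fejerKernel l).indicator measurableSet_Iio

theorem psi_exp_mul_exp_neg_mul_le_integral (l : ℝ) {h : ℝ} (hh : 0 < h) (y : ℝ) :
    Real.exp (-(2 * h)) * (Chebyshev.psi (Real.exp y) * Real.exp (-y)) *
      ((∫ u, fejerKernel l u) - 8 / h) ≤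
      ∫ u, Chebyshev.psi (Real.exp (y + h - u)) * Real.exp (-(y + h - u)) * fejerKernel l u := by
  have h1 := integral_add_compl (measurableSet_Icc (a := -h) (b := h)) (integrable_fejerKernel l)
  have h2 := setIntegral_compl_Icc_fejerKernel_le l hh
  have hB := psi_exp_mul_exp_neg_nonneg y
  calc _ ≤ Real.exp (-(2 * h)) * (Chebyshev.psi (Real.exp y) * Real.exp (-y)) *
        ∫ u in Set.Icc (-h) h, fejerKernel l u := by
        gcongr
        linarith
    _ = ∫ u in Set.Icc (-h) h, Real.exp (-(2 * h)) *
        (Chebyshev.psi (Real.exp y) * Real.exp (-y)) * fejerKernel l u := by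
        rw [integral_const_mul]
    _ ≤ ∫ u in Set.Icc (-h) h, Chebyshev.psi (Real.exp (y + h - u)) *
        Real.exp (-(y + h - u)) * fejerKernel l u := by
        refine setIntegral_mono_on ((integrable_fejerKernel l).const_mul _).integrableOn
          (integrable_psi_exp_mul_fejerKernel l _).integrableOn measurableSet_Icc fun u hu => ?_
        refine mul_le_mul_of_nonneg_right ?_ (fejerKernel_nonneg l u)
        have h3 := psi_exp_mul_exp_neg_le_mul (show y ≤ y + h - u by linarith [hu.2])
        have h4 : Real.exp (y + h - u - y) ≤ Real.exp (2 * h) :=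
          Real.exp_le_exp.2 (by linarith [hu.1])
        rw [Real.exp_neg, inv_mul_le_iff₀ (Real.exp_pos _)]
        exact h3.trans (mul_le_mul_of_nonneg_right h4 (psi_exp_mul_exp_neg_nonneg _))
    _ ≤ _ := setIntegral_le_integral (integrable_psi_exp_mul_fejerKernel l _)
        (Eventually.of_forall fun u => mul_nonneg (psi_exp_mul_exp_neg_nonneg _)
          (fejerKernel_nonneg l u))

theorem integral_psi_exp_mul_fejerKernel_le (l : ℝ) {h : ℝ} (hh : 0 < h) (y : ℝ) :
    ∫ u, Chebyshev.psi (Real.exp (y - h - u)) * Real.exp (-(y - h - u)) * fejerKernel l u ≤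
      Real.exp (2 * h) * (Chebyshev.psi (Real.exp y) * Real.exp (-y)) *
        (∫ u, fejerKernel l u) + (Real.log 4 + 4) * (8 / h) := by
  rw [← integral_add_compl (measurableSet_Icc (a := -h) (b := h))
    (integrable_psi_exp_mul_fejerKernel l _)]
  refine add_le_add ?_ ?_
  · calc _ ≤ ∫ u in Set.Icc (-h) h, Real.exp (2 * h) *
          (Chebyshev.psi (Real.exp y) * Real.exp (-y)) * fejerKernel l u := by
          refine setIntegral_mono_on (integrable_psi_exp_mul_fejerKernel l _).integrableOn
            ((integrable_fejerKernel l).const_mul _).integrableOn measurableSet_Icc fun u hu => ?_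
          refine mul_le_mul_of_nonneg_right ?_ (fejerKernel_nonneg l u)
          have h3 := psi_exp_mul_exp_neg_le_mul (show y - h - u ≤ y by linarith [hu.1])
          have h4 : Real.exp (y - (y - h - u)) ≤ Real.exp (2 * h) :=
            Real.exp_le_exp.2 (by linarith [hu.2])
          exact h3.trans (mul_le_mul_of_nonneg_right h4 (psi_exp_mul_exp_neg_nonneg _))
      _ ≤ ∫ u, Real.exp (2 * h) *
          (Chebyshev.psi (Real.exp y) * Real.exp (-y)) * fejerKernel l u :=
          setIntegral_le_integral ((integrable_fejerKernel l).const_mul _)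
            (Eventually.of_forall fun u => mul_nonneg (mul_nonneg (Real.exp_pos _).le
              (psi_exp_mul_exp_neg_nonneg _)) (fejerKernel_nonneg l u))
      _ = _ := by rw [integral_const_mul]
  · have : 0 ≤ Real.log 4 := Real.log_nonneg (by norm_num)
    calc _ ≤ ∫ u in (Set.Icc (-h) h)ᶜ, (Real.log 4 + 4) * fejerKernel l u := by
          refine setIntegral_mono_on (integrable_psi_exp_mul_fejerKernel l _).integrableOn
            ((integrable_fejerKernel l).const_mul _).integrableOn measurableSet_Icc.compl
            fun u hu => ?_
          exact mul_le_mul_of_nonneg_right (psi_exp_mul_exp_neg_le _) (fejerKernel_nonneg l u)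
      _ ≤ _ := by
          rw [integral_const_mul]
          have := setIntegral_compl_Icc_fejerKernel_le l hh
          gcongr

theorem tendsto_psi_exp_mul_exp_neg :
    Tendsto (fun t : ℝ => Chebyshev.psi (Real.exp t) * Real.exp (-t)) atTop (nhds 1) := by
  set c := ∫ u, fejerKernel 1 u with hc
  have hc0 : 0 < c := integral_fejerKernel_one_pos
  set C := Real.log 4 + 4
  have hU : Tendsto (fun h : ℝ => Real.exp (2 * h) * (1 + h) / (1 - 8 * h / c))
      (nhdsWithin 0 (Set.Ioi 0)) (nhds 1) := by
    have : ContinuousAt (fun h : ℝ => Real.exp (2 * h) * (1 + h) / (1 - 8 * h / c)) 0 :=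
      ContinuousAt.div (by fun_prop) (by fun_prop) (by simp)
    simpa using this.tendsto.mono_left nhdsWithin_le_nhds
  have hL : Tendsto (fun h : ℝ => Real.exp (-(2 * h)) * (1 - h - C * (8 * h / c)))
      (nhdsWithin 0 (Set.Ioi 0)) (nhds 1) := by
    have : ContinuousAt (fun h : ℝ => Real.exp (-(2 * h)) * (1 - h - C * (8 * h / c))) 0 := by
      fun_prop
    simpa using this.tendsto.mono_left nhdsWithin_le_nhds
  have hpos : Tendsto (fun h : ℝ => 1 - 8 * h / c) (nhdsWithin 0 (Set.Ioi 0)) (nhds 1) := by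
    have : ContinuousAt (fun h : ℝ => 1 - 8 * h / c) 0 := by fun_prop
    simpa using this.tendsto.mono_left nhdsWithin_le_nhds
  rw [Metric.tendsto_atTop']
  intro ε hε
  have hself : ∀ᶠ h : ℝ in nhdsWithin 0 (Set.Ioi 0), h ∈ Set.Ioi (0 : ℝ) := self_mem_nhdsWithin
  obtain ⟨h, hh, hUh, hLh, hph⟩ := (hself.and
    ((hU.eventually_lt_const (show (1 : ℝ) < 1 + ε by linarith)).and
    ((hL.eventually_const_lt (show 1 - ε < (1 : ℝ) by linarith)).and
    (hpos.eventually_const_lt one_pos)))).exists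
  rw [Set.mem_Ioi] at hh
  set l := (h ^ 2)⁻¹ with hl
  have hl0 : 0 < l := by positivity
  have hK : ∫ u, fejerKernel l u = l * c := integral_fejerKernel hl0
  have h8 : 8 / h = l * c * (8 * h / c) := by
    rw [hl]; field_simp
  have hlc : 0 < l * c := by positivity
  have hJ := tendsto_integral_psi_exp_mul_fejerKernel hl0
  rw [hK] at hJ
  have h1 := (hJ.comp (tendsto_atTop_add_const_right _ h tendsto_id)).eventually_lt_const
    (show l * c < l * c * (1 + h) by nlinarith)
  have h2 := (hJ.comp (tendsto_atTop_add_const_right _ (-h) tendsto_id)).eventually_const_lt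
    (show l * c * (1 - h) < l * c by nlinarith)
  obtain ⟨Y, hY⟩ := eventually_atTop.1 (h1.and h2)
  refine ⟨Y, fun y hy => ?_⟩
  obtain ⟨h3, h4⟩ := hY y hy.le
  simp only [Function.comp_apply, id, ← sub_eq_add_neg] at h3 h4
  have h5 := (psi_exp_mul_exp_neg_mul_le_integral l hh y).trans_lt h3
  have h6 := h4.trans_le (integral_psi_exp_mul_fejerKernel_le l hh y)
  rw [hK, h8] at h5 h6
  set B := Chebyshev.psi (Real.exp y) * Real.exp (-y)
  have hee : Real.exp (-(2 * h)) * Real.exp (2 * h) = 1 := by rw [← Real.exp_add]; simp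
  rw [Real.dist_eq, abs_lt]
  constructor
  · have h7 : l * c * (1 - h - C * (8 * h / c)) < l * c * (Real.exp (2 * h) * B) := by
      linarith
    have h8 := lt_of_mul_lt_mul_left h7 hlc.le
    have h9 := mul_lt_mul_of_pos_left h8 (Real.exp_pos (-(2 * h)))
    rw [← mul_assoc, hee, one_mul] at h9
    linarith
  · have h7 : l * c * (Real.exp (-(2 * h)) * B * (1 - 8 * h / c)) < l * c * (1 + h) := by
      linarith
    have h8 := lt_of_mul_lt_mul_left h7 hlc.le
    rw [← lt_div_iff₀ hph, Real.exp_neg, inv_mul_lt_iff₀ (Real.exp_pos _), ← mul_div_assoc] at h8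
    linarith

theorem tendsto_psi_div_self : Tendsto (fun x : ℝ => Chebyshev.psi x / x) atTop (nhds 1) := by
  refine (tendsto_psi_exp_mul_exp_neg.comp Real.tendsto_log_atTop).congr' ?_
  filter_upwards [eventually_gt_atTop 0] with x hx
  simp [Real.exp_neg, Real.exp_log hx, div_eq_mul_inv]

theorem tendsto_theta_div_self : Tendsto (fun x : ℝ => Chebyshev.theta x / x) atTop (nhds 1) := by
  have h1 : Tendsto (fun x : ℝ => (Chebyshev.psi x - Chebyshev.theta x) / x) atTop (nhds 0) := by
    refine (Chebyshev.isBigO_psi_sub_theta_sqrt.trans_isLittleO ?_).tendsto_div_nhds_zero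
    refine (Asymptotics.isLittleO_iff_tendsto' ?_).2 ?_
    · filter_upwards [eventually_gt_atTop 0] with x hx h using absurd h hx.ne'
    · refine (tendsto_inv_atTop_zero.comp Real.tendsto_sqrt_atTop).congr fun x => ?_
      simp [Real.sqrt_div_self]
  simpa [sub_div] using tendsto_psi_div_self.sub h1

/-- The **prime number theorem**. -/
theorem tendsto_primeCounting_mul_log_div_self :
    Tendsto (fun x : ℝ => (Nat.primeCounting ⌊x⌋₊ : ℝ) * Real.log x / x) atTop (nhds 1) := by
  have h1 := Chebyshev.primeCounting_sub_theta_div_log_isBigO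
  have h2 : Tendsto (fun x : ℝ =>
      ((Nat.primeCounting ⌊x⌋₊ : ℝ) - Chebyshev.theta x / Real.log x) / (x / Real.log x))
      atTop (nhds 0) := by
    refine (h1.trans_isLittleO ?_).tendsto_div_nhds_zero
    refine Asymptotics.isLittleO_of_tendsto' ?_ ?_
    · filter_upwards [eventually_gt_atTop 1] with x hx h
      have := Real.log_pos hx
      have h0 : x / Real.log x ≠ 0 := by positivity
      exact absurd h h0
    · refine Real.tendsto_log_atTop.inv_tendsto_atTop.congr' ?_
      filter_upwards [eventually_gt_atTop 1] with x hx
      have := Real.log_pos hx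
      simp only [Pi.inv_apply]
      field_simp
  have h3 := h2.add tendsto_theta_div_self
  rw [zero_add] at h3
  refine h3.congr' ?_
  filter_upwards [eventually_gt_atTop 1] with x hx
  have := Real.log_pos hx
  field_simp
  ring

end PNT

section SelbergWeights

open ArithmeticFunction in
theorem sum_filter_dvd_moebius {D l m : ℕ} (hl : 0 < l) (hm : 0 < m) (hmD : m ≤ D) :
    ∑ d ∈ Finset.Icc 1 D with l ∣ d ∧ d ∣ m, moebius (m / d) = if m = l then 1 else 0 := by
  by_cases hlm : l ∣ m
  · obtain ⟨k, rfl⟩ := hlm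
    have hk : 0 < k := Nat.pos_of_mul_pos_left hm
    have h1 : (Finset.Icc 1 D).filter (fun d => l ∣ d ∧ d ∣ l * k) =
        k.divisors.image (fun e => l * e) := by
      ext d
      simp only [Finset.mem_filter, Finset.mem_Icc, Finset.mem_image, Nat.mem_divisors]
      constructor
      · rintro ⟨_, ⟨e, rfl⟩, h⟩
        exact ⟨e, ⟨Nat.dvd_of_mul_dvd_mul_left hl h, hk.ne'⟩, rfl⟩
      · rintro ⟨e, ⟨he, _⟩, rfl⟩
        have h2 : l * e ∣ l * k := Nat.mul_dvd_mul_left l he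
        exact ⟨⟨Nat.pos_of_dvd_of_pos h2 hm, (Nat.le_of_dvd hm h2).trans hmD⟩,
          dvd_mul_right _ _, h2⟩
    rw [h1, Finset.sum_image fun a _ b _ h => Nat.eq_of_mul_eq_mul_left hl h]
    simp_rw [Nat.mul_div_mul_left _ _ hl]
    rw [Nat.sum_div_divisors k (fun e => moebius e), ← coe_mul_zeta_apply,
      moebius_mul_coe_zeta, one_apply]
    refine if_congr ?_ rfl rfl
    constructor
    · rintro rfl; simp
    · intro h
      exact Nat.eq_of_mul_eq_mul_left hl (by simpa using h)
  · rw [if_neg (fun h : m = l => hlm (h ▸ dvd_rfl)), Finset.filter_false_of_mem, Finset.sum_empty]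
    rintro d - ⟨h1, h2⟩
    exact hlm (h1.trans h2)

theorem sum_Icc_inv_sq_le (D : ℕ) : ∑ m ∈ Finset.Icc 1 D, ((m : ℝ) ^ 2)⁻¹ ≤ 2 := by
  have h : ∀ n : ℕ, ∑ m ∈ Finset.Icc 1 (n + 1), ((m : ℝ) ^ 2)⁻¹ ≤ 2 - 1 / (n + 1) := by
    intro n
    induction n with
    | zero => norm_num
    | succ n ih =>
      rw [Finset.sum_Icc_succ_top (by omega)]
      have : (((n + 1 + 1 : ℕ) : ℝ) ^ 2)⁻¹ ≤ 1 / (n + 1) - 1 / ((n + 1 : ℕ) + 1) := by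
        push_cast
        rw [div_sub_div _ _ (by positivity) (by positivity), inv_eq_one_div,
          div_le_div_iff₀ (by positivity) (by positivity)]
        nlinarith [(n.cast_nonneg : (0 : ℝ) ≤ n)]
      linarith
  rcases D with _ | n
  · simp
  · have := h n
    have : (0 : ℝ) ≤ 1 / (n + 1) := by positivity
    linarith [h n]

theorem log_le_two_mul_sum_squarefree_inv (D : ℕ) :
    Real.log D ≤ 2 * ∑ l ∈ Finset.Icc 1 D, ((ArithmeticFunction.moebius l : ℤ) : ℝ) ^ 2 / l := by
  set f : ℕ × ℕ → ℝ := fun p =>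
    ((ArithmeticFunction.moebius p.1 : ℤ) : ℝ) ^ 2 / p.1 * ((p.2 : ℝ) ^ 2)⁻¹ with hf
  have hf0 : ∀ p, 0 ≤ f p := fun p => by simp only [hf]; positivity
  have h1 : Real.log D ≤ ∑ n ∈ Finset.Icc 1 D, (n : ℝ)⁻¹ := by
    have := log_add_one_le_harmonic D
    rw [harmonic_eq_sum_Icc] at this
    push_cast at this
    rcases D with _ | D
    · simp
    · exact (Real.log_le_log (by positivity) (by linarith)).trans this
  have h2 : ∑ n ∈ Finset.Icc 1 D, (n : ℝ)⁻¹ ≤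
      ∑ n ∈ Finset.Icc 1 D, ∑ p ∈ Finset.Icc 1 D ×ˢ Finset.Icc 1 D,
        if p.2 ^ 2 * p.1 = n then f p else 0 := by
    refine Finset.sum_le_sum fun n hn => ?_
    rw [Finset.mem_Icc] at hn
    obtain ⟨a, b, hab, ha⟩ := Nat.sq_mul_squarefree n
    have hn0 : 0 < b ^ 2 * a := by omega
    have ha0 : 0 < a := Nat.pos_of_mul_pos_left hn0
    have hb0 : 0 < b := by
      rcases Nat.eq_zero_or_pos b with rfl | h
      · simp at hn0
      · exact h
    have hle : (a, b) ∈ Finset.Icc 1 D ×ˢ Finset.Icc 1 D := by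
      simp only [Finset.mem_product, Finset.mem_Icc]
      refine ⟨⟨ha0, ?_⟩, hb0, ?_⟩
      · nlinarith [Nat.pow_pos (n := 2) hb0]
      · nlinarith
    refine le_trans ?_ (Finset.single_le_sum (f := fun p : ℕ × ℕ =>
      if p.2 ^ 2 * p.1 = n then f p else 0) (fun p _ => ?_) hle)
    · simp only [hf]
      rw [if_pos hab, ← hab]
      have h3 : ((ArithmeticFunction.moebius a : ℤ) : ℝ) ^ 2 = 1 := by
        exact_mod_cast ArithmeticFunction.moebius_sq_eq_one_of_squarefree ha
      rw [h3]
      push_cast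
      rw [mul_inv]
      simp [mul_comm]
    · split_ifs
      · exact hf0 p
      · exact le_rfl
  have h3 : ∑ n ∈ Finset.Icc 1 D, ∑ p ∈ Finset.Icc 1 D ×ˢ Finset.Icc 1 D,
        (if p.2 ^ 2 * p.1 = n then f p else 0) ≤
      ∑ p ∈ Finset.Icc 1 D ×ˢ Finset.Icc 1 D, f p := by
    rw [Finset.sum_comm]
    refine Finset.sum_le_sum fun p _ => ?_
    rw [Finset.sum_ite_eq]
    split_ifs
    · exact le_rfl
    · exact hf0 p
  have h4 : ∑ p ∈ Finset.Icc 1 D ×ˢ Finset.Icc 1 D, f p =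
      (∑ l ∈ Finset.Icc 1 D, ((ArithmeticFunction.moebius l : ℤ) : ℝ) ^ 2 / l) *
        ∑ m ∈ Finset.Icc 1 D, ((m : ℝ) ^ 2)⁻¹ := by
    rw [Finset.sum_product, Finset.sum_mul_sum]
  have h5 : 0 ≤ ∑ l ∈ Finset.Icc 1 D, ((ArithmeticFunction.moebius l : ℤ) : ℝ) ^ 2 / l :=
    Finset.sum_nonneg fun _ _ => by positivity
  calc _ ≤ _ := h1.trans (h2.trans h3)
    _ ≤ _ := by
      rw [h4, mul_comm]
      exact mul_le_mul_of_nonneg_right (sum_Icc_inv_sq_le D) h5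

theorem sum_sum_div_lcm (D : ℕ) (w : ℕ → ℝ) :
    ∑ d ∈ Finset.Icc 1 D, ∑ e ∈ Finset.Icc 1 D, w d * w e / (Nat.lcm d e : ℝ) =
      ∑ l ∈ Finset.Icc 1 D, (Nat.totient l : ℝ) *
        (∑ d ∈ Finset.Icc 1 D with l ∣ d, w d / d) ^ 2 := by
  have h1 : ∀ d ∈ Finset.Icc 1 D, ∀ e ∈ Finset.Icc 1 D, w d * w e / (Nat.lcm d e : ℝ) =
      ∑ l ∈ Finset.Icc 1 D, (Nat.totient l : ℝ) *
        ((if l ∣ d then w d / d else 0) * (if l ∣ e then w e / e else 0)) := by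
    intro d hd e he
    rw [Finset.mem_Icc] at hd he
    have hd0 : (d : ℝ) ≠ 0 := by exact_mod_cast (by omega : d ≠ 0)
    have he0 : (e : ℝ) ≠ 0 := by exact_mod_cast (by omega : e ≠ 0)
    have hg : 0 < Nat.gcd d e := Nat.gcd_pos_of_pos_left _ hd.1
    have h2 : (Nat.gcd d e : ℝ) = ∑ l ∈ Finset.Icc 1 D with l ∣ d ∧ l ∣ e,
        (Nat.totient l : ℝ) := by
      rw [← Nat.sum_totient (Nat.gcd d e)]
      push_cast
      refine Finset.sum_congr ?_ fun _ _ => rfl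
      ext l
      simp only [Nat.mem_divisors, Finset.mem_filter, Finset.mem_Icc, Nat.dvd_gcd_iff]
      constructor
      · rintro ⟨⟨h, h'⟩, _⟩
        exact ⟨⟨Nat.pos_of_dvd_of_pos h hd.1, (Nat.le_of_dvd hd.1 h).trans hd.2⟩, h, h'⟩
      · rintro ⟨_, h⟩
        exact ⟨h, hg.ne'⟩
    have h3 : (Nat.gcd d e : ℝ) * Nat.lcm d e = d * e := by
      exact_mod_cast Nat.gcd_mul_lcm d e
    have h4 : (Nat.lcm d e : ℝ) ≠ 0 := by
      exact_mod_cast Nat.lcm_ne_zero (by omega) (by omega)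
    calc w d * w e / (Nat.lcm d e : ℝ) = (Nat.gcd d e : ℝ) * (w d / d * (w e / e)) := by
          field_simp
          linear_combination (-(w d * w e)) * h3
      _ = _ := by
          rw [h2, Finset.sum_mul, Finset.sum_filter]
          refine Finset.sum_congr rfl fun l _ => ?_
          by_cases h5 : l ∣ d <;> by_cases h6 : l ∣ e <;> simp [h5, h6]
  rw [Finset.sum_congr rfl fun d hd => Finset.sum_congr rfl fun e he => h1 d hd e he]
  simp_rw [Finset.sum_comm (s := Finset.Icc 1 D) (t := Finset.Icc 1 D)
    (f := fun e l => (Nat.totient l : ℝ) * (_ * (if l ∣ e then w e / e else 0)))]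
  rw [Finset.sum_comm]
  refine Finset.sum_congr rfl fun l _ => ?_
  rw [Finset.sum_filter, sq, Finset.sum_mul_sum, Finset.mul_sum]
  refine Finset.sum_congr rfl fun d _ => ?_
  rw [Finset.mul_sum]

theorem exists_selberg_weights {D : ℕ} (hD : 2 ≤ D) : ∃ w : ℕ → ℝ, w 1 = 1 ∧
    (∀ d ∈ Finset.Icc 1 D, |w d| ≤ (D : ℝ) ^ 2) ∧
    0 ≤ ∑ d ∈ Finset.Icc 1 D, ∑ e ∈ Finset.Icc 1 D, w d * w e / (Nat.lcm d e : ℝ) ∧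
    ∑ d ∈ Finset.Icc 1 D, ∑ e ∈ Finset.Icc 1 D, w d * w e / (Nat.lcm d e : ℝ) ≤
      2 / Real.log D := by
  set S := ∑ l ∈ Finset.Icc 1 D, ((ArithmeticFunction.moebius l : ℤ) : ℝ) ^ 2 / l with hS
  have hS1 : 1 ≤ S := by
    refine le_trans ?_ (Finset.single_le_sum (f := fun l : ℕ =>
      ((ArithmeticFunction.moebius l : ℤ) : ℝ) ^ 2 / l) (fun l _ => by positivity)
      (Finset.mem_Icc.2 ⟨le_rfl, by omega⟩ : 1 ∈ Finset.Icc 1 D))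
    simp
  have hS0 : 0 < S := by linarith
  have hSlog : Real.log D ≤ 2 * S := log_le_two_mul_sum_squarefree_inv D
  set y : ℕ → ℝ := fun l => ((ArithmeticFunction.moebius l : ℤ) : ℝ) / (l * S) with hy
  have hmu : ∀ n, |((ArithmeticFunction.moebius n : ℤ) : ℝ)| ≤ 1 := fun n => by
    exact_mod_cast ArithmeticFunction.abs_moebius_le_one
  set w : ℕ → ℝ := fun d => d * ∑ l ∈ Finset.Icc 1 D with d ∣ l,
    ((ArithmeticFunction.moebius (l / d) : ℤ) : ℝ) * y l with hw
  have hinv : ∀ l ∈ Finset.Icc 1 D, ∑ d ∈ Finset.Icc 1 D with l ∣ d, w d / d = y l := by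
    intro l hl
    have h1 : ∀ d ∈ (Finset.Icc 1 D).filter (l ∣ ·), w d / d = ∑ m ∈ Finset.Icc 1 D,
        if d ∣ m then ((ArithmeticFunction.moebius (m / d) : ℤ) : ℝ) * y m else 0 := by
      intro d hd
      have hd0 : (d : ℝ) ≠ 0 := by
        simp only [Finset.mem_filter, Finset.mem_Icc] at hd
        exact_mod_cast (by omega : d ≠ 0)
      simp only [hw]
      rw [mul_div_cancel_left₀ _ hd0, Finset.sum_filter]
    rw [Finset.sum_congr rfl h1, Finset.sum_comm]
    have h2 : ∀ m ∈ Finset.Icc 1 D, (∑ d ∈ Finset.Icc 1 D with l ∣ d,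
        if d ∣ m then ((ArithmeticFunction.moebius (m / d) : ℤ) : ℝ) * y m else 0) =
        if m = l then y m else 0 := by
      intro m hm
      rw [Finset.mem_Icc] at hm hl
      rw [← Finset.sum_filter, Finset.filter_filter, ← Finset.sum_mul]
      have h3 := sum_filter_dvd_moebius (D := D) (l := l) (m := m) hl.1 hm.1 hm.2
      have h4 : (∑ d ∈ Finset.Icc 1 D with l ∣ d ∧ d ∣ m,
          ((ArithmeticFunction.moebius (m / d) : ℤ) : ℝ)) = if m = l then 1 else 0 := by
        exact_mod_cast congrArg (Int.cast : ℤ → ℝ) h3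
      rw [h4]
      split_ifs <;> simp
    rw [Finset.sum_congr rfl h2, Finset.sum_ite_eq', if_pos hl]
  refine ⟨w, ?_, ?_, ?_, ?_⟩
  · simp only [hw, hy, Nat.cast_one, one_mul, one_dvd, Finset.filter_true, Nat.div_one]
    have : ∀ l ∈ Finset.Icc 1 D, ((ArithmeticFunction.moebius l : ℤ) : ℝ) *
        (((ArithmeticFunction.moebius l : ℤ) : ℝ) / (l * S)) =
        ((ArithmeticFunction.moebius l : ℤ) : ℝ) ^ 2 / l * S⁻¹ := by
      intro l _
      rw [← mul_div_assoc, ← sq, ← div_div, div_eq_mul_inv _ S]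
    rw [Finset.sum_congr rfl this, ← Finset.sum_mul, ← hS, mul_inv_cancel₀ hS0.ne']
  · intro d hd
    rw [Finset.mem_Icc] at hd
    have hdD : (d : ℝ) ≤ D := by exact_mod_cast hd.2
    simp only [hw]
    rw [abs_mul, Nat.abs_cast, sq]
    refine mul_le_mul hdD ?_ (abs_nonneg _) (Nat.cast_nonneg _)
    refine (Finset.abs_sum_le_sum_abs _ _).trans ?_
    have h1 : ∀ l ∈ (Finset.Icc 1 D).filter (d ∣ ·),
        |((ArithmeticFunction.moebius (l / d) : ℤ) : ℝ) * y l| ≤ 1 := by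
      intro l hl
      simp only [Finset.mem_filter, Finset.mem_Icc] at hl
      have hl1 : (1 : ℝ) ≤ l := by exact_mod_cast hl.1.1
      rw [abs_mul]
      refine mul_le_one₀ (hmu _) (abs_nonneg _) ?_
      simp only [hy]
      rw [abs_div, abs_of_pos (show (0 : ℝ) < l * S by positivity)]
      refine div_le_one_of_le₀ ((hmu l).trans ?_) (by positivity)
      nlinarith
    refine (Finset.sum_le_sum h1).trans ?_
    rw [Finset.sum_const, nsmul_eq_mul, mul_one]
    have := Finset.card_filter_le (Finset.Icc 1 D) (d ∣ ·)
    rw [Nat.card_Icc] at this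
    exact_mod_cast (by omega)
  · rw [sum_sum_div_lcm]
    exact Finset.sum_nonneg fun l _ => by positivity
  · rw [sum_sum_div_lcm]
    have hlog : 0 < Real.log D := Real.log_pos (by exact_mod_cast hD)
    calc _ ≤ ∑ l ∈ Finset.Icc 1 D,
          ((ArithmeticFunction.moebius l : ℤ) : ℝ) ^ 2 / l * (S⁻¹) ^ 2 := by
          refine Finset.sum_le_sum fun l hl => ?_
          rw [hinv l hl]
          rw [Finset.mem_Icc] at hl
          have hl0 : (0 : ℝ) < l := by exact_mod_cast hl.1
          have ht : (Nat.totient l : ℝ) ≤ l := by exact_mod_cast Nat.totient_le l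
          calc (Nat.totient l : ℝ) * y l ^ 2 ≤ l * y l ^ 2 := by gcongr
            _ = _ := by simp only [hy]; field_simp
      _ = S⁻¹ := by
          rw [← Finset.sum_mul, ← hS]; field_simp
      _ ≤ 2 / Real.log D := by
          rw [inv_eq_one_div, div_le_div_iff₀ hS0 hlog]
          linarith

end SelbergWeights

section Equidistribution

theorem injOn_emod_add_mul {q : ℕ} {u : ℤ} (hu : IsCoprime u q) (m : ℤ) :
    Set.InjOn (fun j : ℕ => ((m + j * u) % q).toNat) (Finset.range q : Set ℕ) := by
  intro i hi j hj hij
  simp only [Finset.coe_range, Set.mem_Iio] at hi hj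
  have hq : (0 : ℤ) < q := by omega
  have h1 := Int.emod_nonneg (m + i * u) hq.ne'
  have h2 := Int.emod_nonneg (m + j * u) hq.ne'
  have h3 : (m + i * u) % q = (m + j * u) % q := by
    dsimp only at hij
    omega
  have h4 : (q : ℤ) ∣ ((i : ℤ) - j) * u := by
    have h5 := Int.ModEq.dvd (show m + j * u ≡ m + i * u [ZMOD q] from h3.symm)
    convert h5 using 1
    ring
  have h5 : (q : ℤ) ∣ (i : ℤ) - j := hu.symm.dvd_of_dvd_mul_right h4
  have h6 := Int.eq_zero_of_abs_lt_dvd h5 (by rw [abs_lt]; constructor <;> omega)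
  omega

theorem fract_lt_bounds {q : ℕ} (hq : 0 < q) {s : ℤ} {x e δ : ℝ} (hx : q * x = s + e)
    (he : -1 ≤ e) (he' : e < 2) (h1 : 1 ≤ s % q) (h2 : s % q + 3 ≤ q) :
    (((s % q : ℤ) : ℝ) + 2 < δ * q → Int.fract x < δ) ∧
    (Int.fract x < δ → ((s % q : ℤ) : ℝ) - 1 < δ * q) := by
  have hq0 : (0 : ℝ) < q := by exact_mod_cast hq
  have h1' : (1 : ℝ) ≤ ((s % q : ℤ) : ℝ) := by exact_mod_cast h1
  have h2' : ((s % q : ℤ) : ℝ) + 3 ≤ q := by exact_mod_cast h2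
  have h3 : (s : ℝ) = ((s % q : ℤ) : ℝ) + q * ((s / q : ℤ) : ℝ) := by
    exact_mod_cast (Int.emod_add_mul_ediv s q).symm
  have hfr : Int.fract x = (((s % q : ℤ) : ℝ) + e) / q := by
    rw [Int.fract_eq_iff]
    refine ⟨div_nonneg (by linarith) hq0.le, (div_lt_one hq0).2 (by linarith), s / q, ?_⟩
    have : x = (s + e) / q := by rw [← hx]; field_simp
    rw [this, h3]
    field_simp
    ring
  rw [hfr, div_lt_iff₀ hq0]
  constructor <;> intro h <;> linarith

theorem abs_card_filter_fract_sub_le {q : ℕ} (hq : 0 < q) {u : ℤ} (hu : IsCoprime u q)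
    {θ : ℝ} (hθ : |θ - u / q| ≤ 1 / (q : ℝ) ^ 2) (c : ℝ) {δ : ℝ} (hδ : 0 ≤ δ) (hδ' : δ ≤ 1) :
    |((((Finset.range q).filter fun j : ℕ => Int.fract (c + j * θ) < δ).card : ℕ) : ℝ) - δ * q| ≤
      5 := by
  have hq0 : (0 : ℝ) < q := by exact_mod_cast hq
  have hqz : (0 : ℤ) < q := by exact_mod_cast hq
  set m := ⌊q * c⌋ with hm
  set r : ℕ → ℕ := fun j => ((m + j * u) % q).toNat with hr
  have hinj : Set.InjOn r (Finset.range q : Set ℕ) := injOn_emod_add_mul hu m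
  have hrz : ∀ j, (r j : ℤ) = (m + j * u) % q := fun j =>
    Int.toNat_of_nonneg (Int.emod_nonneg _ hqz.ne')
  have hrR : ∀ j, (r j : ℝ) = (((m + j * u) % q : ℤ) : ℝ) := fun j => by
    rw [← hrz j, Int.cast_natCast]
  have hrlt : ∀ j, r j < q := fun j => by
    have := Int.emod_lt_of_pos (m + j * u) hqz
    have := hrz j
    omega
  have himage : (Finset.range q).image r = Finset.range q := by
    refine Finset.eq_of_subset_of_card_le ?_ ?_
    · intro i hi
      obtain ⟨j, _, rfl⟩ := Finset.mem_image.1 hi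
      exact Finset.mem_range.2 (hrlt j)
    · rw [Finset.card_image_of_injOn hinj]
  have hb : ∀ j < q, 1 ≤ r j → r j + 3 ≤ q →
      ((r j : ℝ) + 2 < δ * q → Int.fract (c + j * θ) < δ) ∧
      (Int.fract (c + j * θ) < δ → (r j : ℝ) - 1 < δ * q) := by
    intro j hj h1 h2
    have hj0 : (j : ℝ) < q := by exact_mod_cast hj
    have hz := hrz j
    have herr : |(q : ℝ) * j * (θ - u / q)| ≤ 1 := by
      rw [abs_mul, abs_of_nonneg (by positivity)]
      calc (q : ℝ) * j * |θ - u / q| ≤ q * q * (1 / (q : ℝ) ^ 2) := by gcongr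
        _ = 1 := by field_simp
    rw [abs_le] at herr
    have hx : (q : ℝ) * (c + j * θ) = ((m + j * u : ℤ) : ℝ) +
        (Int.fract (q * c) + q * j * (θ - u / q)) := by
      have := Int.floor_add_fract (q * c)
      push_cast
      field_simp
      linear_combination (-1 : ℝ) * this
    have := fract_lt_bounds (δ := δ) hq hx (by linarith [Int.fract_nonneg (q * c)])
      (by linarith [Int.fract_lt_one (q * c)]) (by omega) (by omega)
    rwa [← hrR j] at this
  set A := (Finset.range q).filter fun j : ℕ => Int.fract (c + j * θ) < δ with hA
  have hAcard : (A.image r).card = A.card :=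
    Finset.card_image_of_injOn (hinj.mono (Finset.coe_subset.2 (Finset.filter_subset _ _)))
  have hupper : A.image r ⊆ Finset.range ⌈δ * q + 1⌉₊ ∪ {q - 2, q - 1} := by
    intro i hi
    obtain ⟨j, hj, rfl⟩ := Finset.mem_image.1 hi
    simp only [hA, Finset.mem_filter, Finset.mem_range] at hj
    simp only [Finset.mem_union, Finset.mem_range, Finset.mem_insert, Finset.mem_singleton]
    have hlt := hrlt j
    by_cases h1 : 1 ≤ r j
    · by_cases h2 : r j + 3 ≤ q
      · left
        rw [Nat.lt_ceil]
        linarith [(hb j hj.1 h1 h2).2 hj.2]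
      · right; omega
    · left
      have : r j = 0 := by omega
      rw [this, Nat.lt_ceil]
      push_cast
      positivity
  have hlower : Finset.range ⌈δ * q - 2⌉₊ ⊆ A.image r ∪ {0, q - 2, q - 1} := by
    intro i hi
    rw [Finset.mem_range, Nat.lt_ceil] at hi
    have hiq : i < q := by
      have : (i : ℝ) < q := by nlinarith
      exact_mod_cast this
    have : i ∈ (Finset.range q).image r := by rw [himage]; exact Finset.mem_range.2 hiq
    obtain ⟨j, hj, rfl⟩ := Finset.mem_image.1 this
    simp only [Finset.mem_union, Finset.mem_insert, Finset.mem_singleton]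
    by_cases h1 : 1 ≤ r j
    · by_cases h2 : r j + 3 ≤ q
      · left
        refine Finset.mem_image_of_mem r (Finset.mem_filter.2 ⟨hj, ?_⟩)
        exact (hb j (Finset.mem_range.1 hj) h1 h2).1 (by linarith)
      · right; omega
    · right; omega
  have hu1 := (Finset.card_le_card hupper).trans (Finset.card_union_le _ _)
  have hl1 := (Finset.card_le_card hlower).trans (Finset.card_union_le _ _)
  rw [Finset.card_range, hAcard] at hu1 hl1
  have hu2 : A.card ≤ ⌈δ * q + 1⌉₊ + 2 := hu1.trans (by gcongr; exact Finset.card_le_two)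
  have hl2 : ⌈δ * q - 2⌉₊ ≤ A.card + 3 := hl1.trans (by gcongr; exact Finset.card_le_three)
  have hu3 : (A.card : ℝ) ≤ ⌈δ * q + 1⌉₊ + 2 := by exact_mod_cast hu2
  have hl3 : (⌈δ * q - 2⌉₊ : ℝ) ≤ A.card + 3 := by exact_mod_cast hl2
  have hu4 := Nat.ceil_lt_add_one (show 0 ≤ δ * q + 1 by positivity)
  have hl4 := Nat.le_ceil (δ * q - 2)
  rw [abs_le]
  constructor <;> linarith

theorem abs_card_filter_fract_sub_le_of_length {q : ℕ} (hq : 0 < q) {u : ℤ}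
    (hu : IsCoprime u q) {θ : ℝ} (hθ : |θ - u / q| ≤ 1 / (q : ℝ) ^ 2) {δ : ℝ} (hδ : 0 ≤ δ)
    (hδ' : δ ≤ 1) (K : ℕ) (c : ℝ) :
    |((((Finset.range K).filter fun j : ℕ => Int.fract (c + j * θ) < δ).card : ℕ) : ℝ) - δ * K| ≤
      5 * K / q + q := by
  have hq0 : (0 : ℝ) < q := by exact_mod_cast hq
  induction K using Nat.strong_induction_on generalizing c with
  | _ K ih =>
    rcases lt_or_ge K q with hK | hK
    · have h1 := Finset.card_filter_le (Finset.range K) fun j : ℕ => Int.fract (c + j * θ) < δ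
      rw [Finset.card_range] at h1
      have h1' : ((((Finset.range K).filter
        fun j : ℕ => Int.fract (c + j * θ) < δ).card : ℕ) : ℝ) ≤ K := by exact_mod_cast h1
      have h0 : (0 : ℝ) ≤ ((((Finset.range K).filter
        fun j : ℕ => Int.fract (c + j * θ) < δ).card : ℕ) : ℝ) := Nat.cast_nonneg _
      have hKq : (K : ℝ) ≤ q := by exact_mod_cast hK.le
      have h2 : 0 ≤ δ * K := by positivity
      have h3 : δ * K ≤ K := mul_le_of_le_one_left (Nat.cast_nonneg _) hδ'
      have h4 : (0 : ℝ) ≤ 5 * K / q := by positivity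
      rw [abs_le]
      constructor <;> linarith
    · obtain ⟨n, rfl⟩ := Nat.exists_eq_add_of_le hK
      have h1 := abs_card_filter_fract_sub_le hq hu hθ c hδ hδ'
      have h2 := ih n (by omega) (c + q * θ)
      have h3 : ((Finset.range (q + n)).filter fun j : ℕ => Int.fract (c + j * θ) < δ).card =
          ((Finset.range q).filter fun j : ℕ => Int.fract (c + j * θ) < δ).card +
          ((Finset.range n).filter fun j : ℕ => Int.fract (c + q * θ + j * θ) < δ).card := by
        simp only [Finset.card_filter]
        rw [Finset.sum_range_add]
        congr 1
        refine Finset.sum_congr rfl fun j _ => ?_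
        push_cast
        ring_nf
      rw [h3]
      push_cast
      rw [abs_le] at *
      have h4 : 5 * ((q : ℝ) + n) / q = 5 + 5 * n / q := by field_simp
      rw [h4]
      constructor <;> linarith [h1.1, h1.2, h2.1, h2.2]

theorem dvd_floor_iff_fract_lt {L : ℕ} (hL : 0 < L) (x : ℝ) :
    (L : ℤ) ∣ ⌊x⌋ ↔ Int.fract (x / L) < 1 / L := by
  have hL0 : (0 : ℝ) < L := by exact_mod_cast hL
  have hfl := Int.floor_le x
  have hfl' := Int.lt_floor_add_one x
  constructor
  · rintro ⟨k, hk⟩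
    have hk' : ((⌊x⌋ : ℤ) : ℝ) = L * k := by rw [hk]; push_cast; rfl
    have h1 : ⌊x / L⌋ = k := by
      rw [Int.floor_eq_iff, le_div_iff₀ hL0, div_lt_iff₀ hL0]
      have : (1 : ℝ) ≤ L := by exact_mod_cast hL
      constructor <;> nlinarith
    rw [Int.fract, h1, div_sub' hL0.ne', div_lt_div_iff_of_pos_right hL0]
    linarith
  · intro h
    refine ⟨⌊x / L⌋, ?_⟩
    rw [Int.floor_eq_iff]
    push_cast
    have h1 := Int.floor_add_fract (x / L)
    have h2 := Int.fract_nonneg (x / L)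
    rw [lt_div_iff₀ hL0] at h
    have h3 : x = L * (⌊x / L⌋ : ℝ) + Int.fract (x / L) * L := by
      rw [mul_comm (Int.fract _), ← mul_add, h1]
      field_simp
    have h4 := mul_nonneg h2 hL0.le
    constructor <;> linarith

theorem abs_card_dvd_floor_sub_le {L₁ L₂ : ℕ} (hL₁ : 0 < L₁) (hL₂ : 0 < L₂) (α β : ℝ) (N : ℕ)
    {q : ℕ} (hq : 0 < q) {u : ℤ} (hu : IsCoprime u q)
    (hθ : |α * L₁ / L₂ - u / q| ≤ 1 / (q : ℝ) ^ 2) :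
    |((((Finset.Icc 1 N).filter fun n : ℕ => L₁ ∣ n ∧ (L₂ : ℤ) ∣ ⌊α * n + β⌋).card : ℕ) : ℝ) -
      N / (L₁ * L₂)| ≤ 5 * N / q + q + 1 := by
  have hq0 : (0 : ℝ) < q := by exact_mod_cast hq
  have h1 : (1 : ℝ) ≤ L₁ := by exact_mod_cast hL₁
  have h2 : (1 : ℝ) ≤ L₂ := by exact_mod_cast hL₂
  set θ := α * L₁ / L₂ with hθdef
  have hcard : ((Finset.Icc 1 N).filter fun n : ℕ => L₁ ∣ n ∧ (L₂ : ℤ) ∣ ⌊α * n + β⌋).card =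
      ((Finset.range (N / L₁)).filter fun j : ℕ =>
        Int.fract (θ + β / L₂ + j * θ) < 1 / L₂).card := by
    symm
    have hkey : ∀ j : ℕ, (L₂ : ℤ) ∣ ⌊α * (L₁ * (j + 1) : ℕ) + β⌋ ↔
        Int.fract (θ + β / L₂ + j * θ) < 1 / L₂ := by
      intro j
      rw [dvd_floor_iff_fract_lt hL₂]
      have : (α * (L₁ * (j + 1) : ℕ) + β) / L₂ = θ + β / L₂ + j * θ := by
        rw [hθdef]; push_cast; field_simp; ring
      rw [this]
    refine Finset.card_bij (fun j _ => L₁ * (j + 1)) ?_ ?_ ?_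
    · intro j hj
      simp only [Finset.mem_filter, Finset.mem_range, Finset.mem_Icc] at hj ⊢
      refine ⟨⟨Nat.mul_pos hL₁ j.succ_pos, ?_⟩, dvd_mul_right _ _, (hkey j).2 hj.2⟩
      rw [mul_comm]
      exact (Nat.le_div_iff_mul_le hL₁).1 hj.1
    · intro i _ j _ hij
      have := Nat.eq_of_mul_eq_mul_left hL₁ hij
      omega
    · intro n hn
      simp only [Finset.mem_filter, Finset.mem_Icc] at hn
      obtain ⟨⟨hn1, hnN⟩, ⟨k, rfl⟩, hd⟩ := hn
      have hk : 0 < k := Nat.pos_of_mul_pos_left hn1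
      obtain ⟨j, rfl⟩ := Nat.exists_eq_add_of_le' hk
      refine ⟨j, ?_, rfl⟩
      simp only [Finset.mem_filter, Finset.mem_range]
      refine ⟨?_, (hkey j).1 hd⟩
      rw [← Nat.succ_le_iff, Nat.le_div_iff_mul_le hL₁, mul_comm]
      exact hnN
  rw [hcard]
  have h3 := abs_card_filter_fract_sub_le_of_length hq hu hθ (δ := 1 / L₂) (by positivity)
    ((div_le_one (by positivity)).2 h2) (N / L₁) (θ + β / L₂)
  have h4 : ((N / L₁ : ℕ) : ℝ) ≤ N / L₁ := Nat.cast_div_le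
  have h5 : (N : ℝ) / L₁ - 1 < ((N / L₁ : ℕ) : ℝ) := by
    rw [sub_lt_iff_lt_add, div_lt_iff₀ (by positivity)]
    exact_mod_cast Nat.lt_mul_of_div_lt (Nat.lt_succ_self _) hL₁
  have h7 : 5 * ((N / L₁ : ℕ) : ℝ) / q ≤ 5 * N / q := by
    gcongr
    exact Nat.div_le_self _ _
  have h8 : 1 / (L₂ : ℝ) * ((N / L₁ : ℕ) : ℝ) ≤ N / (L₁ * L₂) := by
    calc 1 / (L₂ : ℝ) * ((N / L₁ : ℕ) : ℝ) ≤ 1 / (L₂ : ℝ) * (N / L₁) := by gcongr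
      _ = _ := by field_simp
  have h9 : (N : ℝ) / (L₁ * L₂) - 1 ≤ 1 / (L₂ : ℝ) * ((N / L₁ : ℕ) : ℝ) := by
    have h10 : 1 / (L₂ : ℝ) * (N / L₁ - 1) ≤ 1 / (L₂ : ℝ) * ((N / L₁ : ℕ) : ℝ) := by
      gcongr
    have h11 : 1 / (L₂ : ℝ) ≤ 1 := (div_le_one (by positivity)).2 h2
    have h12 : 1 / (L₂ : ℝ) * (N / L₁ - 1) = N / (L₁ * L₂) - 1 / (L₂ : ℝ) := by
      field_simp
    linarith
  rw [abs_le] at *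
  constructor <;> linarith [h3.1, h3.2]

end Equidistribution

section SieveBound

/-- The reals within `T⁻⁴⁶` of a rational number with denominator at most `T¹⁸`. -/
def nearRationals (T : ℕ) : Set ℝ :=
  ⋃ s ∈ Finset.Icc 1 (T ^ 18), ⋃ v : ℤ, Metric.closedBall ((v : ℝ) / s) (((T : ℝ) ^ 46)⁻¹)

theorem measurableSet_nearRationals (T : ℕ) : MeasurableSet (nearRationals T) :=
  Finset.measurableSet_biUnion _ fun _ _ => MeasurableSet.iUnion fun _ =>
    Metric.isClosed_closedBall.measurableSet

theorem mem_nearRationals {T : ℕ} {α : ℝ} : α ∈ nearRationals T ↔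
    ∃ s : ℕ, 1 ≤ s ∧ s ≤ T ^ 18 ∧ ∃ v : ℤ, |α - v / s| ≤ ((T : ℝ) ^ 46)⁻¹ := by
  simp [nearRationals, Real.dist_eq, and_assoc]

theorem abs_card_dvd_floor_sub_le_of_notMem {T : ℕ} (hT : 2 ≤ T) {α : ℝ}
    (hα : α ∉ nearRationals T) (β : ℝ) {L₁ L₂ : ℕ} (hL₁ : 0 < L₁) (hL₂ : 0 < L₂)
    (hL₁T : L₁ ≤ T ^ 2) (hL₂T : L₂ ≤ T ^ 2) :
    |((((Finset.Icc 1 (T ^ 64)).filter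
      fun n : ℕ => L₁ ∣ n ∧ (L₂ : ℤ) ∣ ⌊α * n + β⌋).card : ℕ) : ℝ) -
      (T : ℝ) ^ 64 / (L₁ * L₂)| ≤ 7 * (T : ℝ) ^ 48 := by
  have hT1 : (1 : ℝ) ≤ T := by exact_mod_cast (by omega : 1 ≤ T)
  have hT0 : (0 : ℝ) < T := by linarith
  have h1 : (1 : ℝ) ≤ L₁ := by exact_mod_cast hL₁
  have h2 : (1 : ℝ) ≤ L₂ := by exact_mod_cast hL₂
  have hL₂T' : (L₂ : ℝ) ≤ (T : ℝ) ^ 2 := by exact_mod_cast hL₂T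
  obtain ⟨ρ, hρ, hden⟩ := Real.exists_rat_abs_sub_le_and_den_le (α * L₁ / L₂)
    (n := T ^ 48) (by positivity)
  push_cast at hρ
  have hd0 : (0 : ℝ) < ρ.den := by exact_mod_cast ρ.den_pos
  have hd1 : (1 : ℝ) ≤ ρ.den := by exact_mod_cast ρ.den_pos
  have hdT : (ρ.den : ℝ) ≤ (T : ℝ) ^ 48 := by exact_mod_cast hden
  have hρ' : (ρ : ℝ) = (ρ.num : ℝ) / ρ.den := by exact_mod_cast (Rat.num_div_den ρ).symm
  rw [hρ'] at hρ
  have hbig : T ^ 16 ≤ ρ.den := by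
    by_contra hlt
    rw [not_le] at hlt
    refine hα (mem_nearRationals.2 ⟨ρ.den * L₁, Nat.mul_pos ρ.den_pos hL₁, ?_,
      ρ.num * L₂, ?_⟩)
    · calc ρ.den * L₁ ≤ T ^ 16 * T ^ 2 := Nat.mul_le_mul hlt.le hL₁T
        _ = T ^ 18 := by ring
    · have h3 : α - ((ρ.num * L₂ : ℤ) : ℝ) / ((ρ.den * L₁ : ℕ) : ℝ) =
          L₂ / L₁ * (α * L₁ / L₂ - ρ.num / ρ.den) := by
        push_cast
        field_simp
      rw [h3, abs_mul, abs_of_nonneg (by positivity)]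
      calc (L₂ : ℝ) / L₁ * |α * L₁ / L₂ - ρ.num / ρ.den|
          ≤ (T : ℝ) ^ 2 * (1 / (((T : ℝ) ^ 48 + 1) * ρ.den)) := by
            gcongr
            exact (div_le_self (by positivity) h1).trans hL₂T'
        _ ≤ (T : ℝ) ^ 2 * (1 / ((T : ℝ) ^ 48 * 1)) := by
            gcongr
            linarith
        _ = _ := by field_simp
  have hcop : IsCoprime ρ.num (ρ.den : ℤ) := by
    rw [Int.isCoprime_iff_nat_coprime]
    simpa using ρ.reduced
  have hbd := abs_card_dvd_floor_sub_le hL₁ hL₂ α β (T ^ 64) ρ.den_pos hcop (hρ.trans (by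
    rw [sq]
    gcongr
    linarith))
  push_cast at hbd
  refine hbd.trans ?_
  have h16 : (T : ℝ) ^ 16 ≤ ρ.den := by exact_mod_cast hbig
  have h3 : 5 * (T : ℝ) ^ 64 / ρ.den ≤ 5 * (T : ℝ) ^ 48 := by
    rw [div_le_iff₀ hd0]
    calc 5 * (T : ℝ) ^ 64 = 5 * (T : ℝ) ^ 48 * (T : ℝ) ^ 16 := by ring
      _ ≤ _ := by gcongr
  have h4 : (1 : ℝ) ≤ (T : ℝ) ^ 48 := one_le_pow₀ hT1
  linarith

theorem sq_sum_filter_dvd (D : ℕ) (w : ℕ → ℝ) (m : ℤ) :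
    (∑ d ∈ Finset.Icc 1 D with ((d : ℕ) : ℤ) ∣ m, w d) ^ 2 =
      ∑ p ∈ Finset.Icc 1 D ×ˢ Finset.Icc 1 D,
        if ((Nat.lcm p.1 p.2 : ℕ) : ℤ) ∣ m then w p.1 * w p.2 else 0 := by
  rw [Finset.sum_filter, sq, Finset.sum_mul_sum, Finset.sum_product]
  refine Finset.sum_congr rfl fun d _ => Finset.sum_congr rfl fun e _ => ?_
  simp only [Int.natCast_dvd, Nat.lcm_dvd_iff]
  by_cases h1 : d ∣ m.natAbs <;> by_cases h2 : e ∣ m.natAbs <;> simp [h1, h2]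

theorem sum_sq_mul_sq_le {D : ℕ} {w : ℕ → ℝ} {B F X R : ℝ} (hB : ∀ d ∈ Finset.Icc 1 D, |w d| ≤ B)
    (hF : ∑ d ∈ Finset.Icc 1 D, ∑ e ∈ Finset.Icc 1 D, w d * w e / (Nat.lcm d e : ℝ) = F)
    (s : Finset ℕ) (m : ℕ → ℤ)
    (hR : ∀ L₁ L₂ : ℕ, 0 < L₁ → 0 < L₂ → L₁ ≤ D ^ 2 → L₂ ≤ D ^ 2 →
      |(((s.filter fun n : ℕ => L₁ ∣ n ∧ (L₂ : ℤ) ∣ m n).card : ℕ) : ℝ) - X / (L₁ * L₂)| ≤ R) :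
    ∑ n ∈ s, (∑ d ∈ Finset.Icc 1 D with ((d : ℕ) : ℤ) ∣ (n : ℤ), w d) ^ 2 *
      (∑ d ∈ Finset.Icc 1 D with ((d : ℕ) : ℤ) ∣ m n, w d) ^ 2 ≤
      X * F ^ 2 + (D : ℝ) ^ 4 * B ^ 4 * R := by
  set P := Finset.Icc 1 D ×ˢ Finset.Icc 1 D with hP
  have hPB : ∀ p ∈ P, |w p.1 * w p.2| ≤ B ^ 2 := by
    intro p hp
    rw [hP, Finset.mem_product] at hp
    rw [abs_mul, sq]
    exact mul_le_mul (hB _ hp.1) (hB _ hp.2) (abs_nonneg _) ((abs_nonneg _).trans (hB _ hp.1))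
  have hPL : ∀ p ∈ P, 0 < Nat.lcm p.1 p.2 ∧ Nat.lcm p.1 p.2 ≤ D ^ 2 := by
    intro p hp
    rw [hP, Finset.mem_product, Finset.mem_Icc, Finset.mem_Icc] at hp
    refine ⟨Nat.lcm_pos (by omega) (by omega), ?_⟩
    rw [sq]
    exact (Nat.le_of_dvd (Nat.mul_pos (by omega) (by omega)) (Nat.lcm_dvd_mul _ _)).trans
      (Nat.mul_le_mul hp.1.2 hp.2.2)
  have hFP : ∑ p ∈ P, w p.1 * w p.2 / (Nat.lcm p.1 p.2 : ℝ) = F := by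
    rw [← hF, hP, Finset.sum_product]
  have h1 : ∑ n ∈ s, (∑ d ∈ Finset.Icc 1 D with ((d : ℕ) : ℤ) ∣ (n : ℤ), w d) ^ 2 *
      (∑ d ∈ Finset.Icc 1 D with ((d : ℕ) : ℤ) ∣ m n, w d) ^ 2 =
      ∑ p ∈ P, ∑ r ∈ P, w p.1 * w p.2 * (w r.1 * w r.2) *
        (((s.filter fun n : ℕ => Nat.lcm p.1 p.2 ∣ n ∧
          ((Nat.lcm r.1 r.2 : ℕ) : ℤ) ∣ m n).card : ℕ) : ℝ) := by
    simp_rw [sq_sum_filter_dvd, Finset.sum_mul_sum]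
    rw [Finset.sum_comm]
    refine Finset.sum_congr rfl fun p _ => ?_
    rw [Finset.sum_comm]
    refine Finset.sum_congr rfl fun r _ => ?_
    rw [Finset.card_filter]
    push_cast
    rw [Finset.mul_sum]
    refine Finset.sum_congr rfl fun n _ => ?_
    simp only [Int.natCast_dvd_natCast]
    by_cases h2 : Nat.lcm p.1 p.2 ∣ n <;>
      by_cases h3 : ((Nat.lcm r.1 r.2 : ℕ) : ℤ) ∣ m n <;> simp [h2, h3]
  have h2 : X * F ^ 2 = ∑ p ∈ P, ∑ r ∈ P, w p.1 * w p.2 * (w r.1 * w r.2) *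
      (X / ((Nat.lcm p.1 p.2 : ℝ) * (Nat.lcm r.1 r.2 : ℝ))) := by
    rw [← hFP, sq, Finset.sum_mul_sum, Finset.mul_sum]
    refine Finset.sum_congr rfl fun p _ => ?_
    rw [Finset.mul_sum]
    refine Finset.sum_congr rfl fun r _ => ?_
    rw [div_mul_div_comm]
    ring
  have hcard : (P.card : ℝ) = (D : ℝ) ^ 2 := by
    rw [hP, Finset.card_product, Nat.card_Icc]
    push_cast
    simp [sq]
  rw [h1, h2, ← sub_le_iff_le_add', ← Finset.sum_sub_distrib]
  simp_rw [← Finset.sum_sub_distrib, ← mul_sub]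
  calc _ ≤ ∑ p ∈ P, ∑ r ∈ P, B ^ 2 * B ^ 2 * R := by
        refine Finset.sum_le_sum fun p hp => Finset.sum_le_sum fun r hr => ?_
        refine (le_abs_self _).trans ?_
        rw [abs_mul, abs_mul]
        have h3 := hR _ _ (hPL p hp).1 (hPL r hr).1 (hPL p hp).2 (hPL r hr).2
        have h4 := hPB p hp
        have h5 := hPB r hr
        gcongr
    _ = _ := by
        rw [Finset.sum_const, Finset.sum_const, nsmul_eq_mul, nsmul_eq_mul, hcard]
        ring

theorem sum_filter_dvd_of_prime {D : ℕ} (hD : 1 ≤ D) (w : ℕ → ℝ) {p : ℕ} (hp : p.Prime)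
    (hpD : D < p) : ∑ d ∈ Finset.Icc 1 D with ((d : ℕ) : ℤ) ∣ (p : ℤ), w d = w 1 := by
  have : (Finset.Icc 1 D).filter (fun d => ((d : ℕ) : ℤ) ∣ (p : ℤ)) = {1} := by
    ext d
    simp only [Finset.mem_filter, Finset.mem_Icc, Finset.mem_singleton, Int.natCast_dvd_natCast,
      Nat.dvd_prime hp]
    constructor
    · rintro ⟨h, h1 | h1⟩ <;> omega
    · rintro rfl; simp [hD]
  rw [this, Finset.sum_singleton]

theorem card_filter_mem_Ico_le {x : ℝ} (y : ℝ) (hx : 0 ≤ x) (s : Finset ℕ)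
    (hs : ∀ n ∈ s, y ≤ n ∧ (n : ℝ) < y + x) : (s.card : ℝ) ≤ x + 1 := by
  have h1 : (s.image fun n : ℕ => (n : ℤ)) ⊆ Finset.Ico ⌈y⌉ ⌈y + x⌉ := by
    intro i hi
    obtain ⟨n, hn, rfl⟩ := Finset.mem_image.1 hi
    rw [Finset.mem_Ico, Int.ceil_le, Int.lt_ceil]
    exact_mod_cast hs n hn
  have h2 := Finset.card_le_card h1
  rw [Finset.card_image_of_injective _ Nat.cast_injective, Int.card_Ico] at h2
  have h3 : ⌈y⌉ ≤ ⌈y + x⌉ := Int.ceil_mono (by linarith)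
  have h4 : ((s.card : ℕ) : ℤ) ≤ ⌈y + x⌉ - ⌈y⌉ := by omega
  have h5 : (s.card : ℝ) ≤ (⌈y + x⌉ : ℝ) - ⌈y⌉ := by exact_mod_cast h4
  linarith [Int.le_ceil y, Int.ceil_lt_add_one (y + x)]

theorem piStar_natCast_eq_card (α β : ℝ) (N : ℕ) : piStar α β N =
    ((Finset.Icc 1 N).filter fun n : ℕ => n.Prime ∧ Nat.Prime (⌊α * n + β⌋).toNat).card := by
  rw [piStar, ← Set.ncard_coe_finset]
  congr 1
  ext p
  simp only [Set.mem_ofPred_eq, Finset.coe_filter, Finset.mem_Icc, Nat.cast_le]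
  constructor
  · rintro ⟨h1, h2, h3⟩
    exact ⟨⟨h1.one_le, h2⟩, h1, h3⟩
  · rintro ⟨⟨_, h2⟩, h1, h3⟩
    exact ⟨h1, h2, h3⟩

theorem piStar_le_of_notMem {a α : ℝ} (ha : 0 < a) (haα : a ≤ α) (β : ℝ) {T : ℕ} (hT : 2 ≤ T)
    (hα : α ∉ nearRationals T) :
    (piStar α β ((T ^ 64 : ℕ) : ℝ) : ℝ) ≤
      (T : ℝ) ^ 64 * (2 / Real.log T) ^ 2 + 7 * (T : ℝ) ^ 60 + (T + T / a + 1) := by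
  obtain ⟨w, hw1, hwD, hF0, hF⟩ := exists_selberg_weights hT
  have hα0 : 0 < α := ha.trans_le haα
  set m : ℕ → ℤ := fun n => ⌊α * n + β⌋ with hm
  set s := Finset.Icc 1 (T ^ 64)
  set U := s.filter fun n : ℕ => n.Prime ∧ Nat.Prime (m n).toNat
  have hsieve := sum_sq_mul_sq_le hwD rfl s m (X := (T : ℝ) ^ 64) (R := 7 * (T : ℝ) ^ 48)
    (fun L₁ L₂ h₁ h₂ h₁' h₂' => abs_card_dvd_floor_sub_le_of_notMem hT hα β h₁ h₂ h₁' h₂')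
  set F := ∑ d ∈ Finset.Icc 1 T, ∑ e ∈ Finset.Icc 1 T, w d * w e / (Nat.lcm d e : ℝ)
  set G : ℕ → ℝ := fun n => (∑ d ∈ Finset.Icc 1 T with ((d : ℕ) : ℤ) ∣ (n : ℤ), w d) ^ 2 *
      (∑ d ∈ Finset.Icc 1 T with ((d : ℕ) : ℤ) ∣ m n, w d) ^ 2 with hG
  have hG0 : ∀ n, 0 ≤ G n := fun n => by positivity
  set U₁ := U.filter fun n => n ≤ T
  set U₂ := U.filter fun n => (m n).toNat ≤ T
  set U₃ := U.filter fun n => T < n ∧ T < (m n).toNat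
  have hcover : U ⊆ U₁ ∪ U₂ ∪ U₃ := by
    intro n hn
    simp only [U₁, U₂, U₃, Finset.mem_union, Finset.mem_filter, hn, true_and]
    omega
  have hU₁ : (U₁.card : ℝ) ≤ T := by
    have : U₁ ⊆ Finset.Icc 1 T := by
      intro n hn
      simp only [U₁, U, s, Finset.mem_filter, Finset.mem_Icc] at hn ⊢
      exact ⟨hn.1.1.1, hn.2⟩
    have := Finset.card_le_card this
    rw [Nat.card_Icc] at this
    exact_mod_cast (by omega : U₁.card ≤ T)
  have hU₂ : (U₂.card : ℝ) ≤ T / a + 1 := by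
    have h1 := card_filter_mem_Ico_le ((1 - β) / α) (x := T / α) (by positivity) U₂ ?_
    · refine h1.trans ?_
      gcongr
    · intro n hn
      simp only [U₂, U, Finset.mem_filter] at hn
      have h2 := hn.1.2.2.one_le
      have h3 : 1 ≤ m n := by omega
      have h4 : m n < T + 1 := by omega
      rw [← add_div, div_le_iff₀ hα0, lt_div_iff₀ hα0]
      simp only [hm] at h3 h4
      rw [Int.le_floor] at h3
      rw [Int.floor_lt] at h4
      push_cast at h3 h4
      constructor <;> linarith
  have hU₃ : (U₃.card : ℝ) ≤ ∑ n ∈ s, G n := by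
    rw [Finset.card_eq_sum_ones]
    push_cast
    calc ∑ n ∈ U₃, (1 : ℝ) = ∑ n ∈ U₃, G n := by
          refine Finset.sum_congr rfl fun n hn => ?_
          simp only [U₃, U, Finset.mem_filter] at hn
          obtain ⟨⟨_, hp1, hp2⟩, h1, h2⟩ := hn
          have h3 : m n = (((m n).toNat : ℕ) : ℤ) := (Int.toNat_of_nonneg (by omega)).symm
          simp only [hG]
          rw [sum_filter_dvd_of_prime (by omega) w hp1 h1, h3,
            sum_filter_dvd_of_prime (by omega) w hp2 h2, hw1]
          norm_num
      _ ≤ _ := Finset.sum_le_sum_of_subset_of_nonneg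
          ((Finset.filter_subset _ _).trans (Finset.filter_subset _ _)) fun n _ _ => hG0 n
  have hcard : (U.card : ℝ) ≤ U₁.card + U₂.card + U₃.card := by
    have := (Finset.card_le_card hcover).trans ((Finset.card_union_le _ _).trans
      (Nat.add_le_add_right (Finset.card_union_le _ _) _))
    exact_mod_cast this
  rw [piStar_natCast_eq_card]
  change (U.card : ℝ) ≤ _
  have hFF : (T : ℝ) ^ 64 * F ^ 2 ≤ (T : ℝ) ^ 64 * (2 / Real.log T) ^ 2 := by gcongr
  have hE : (T : ℝ) ^ 4 * ((T : ℝ) ^ 2) ^ 4 * (7 * (T : ℝ) ^ 48) = 7 * (T : ℝ) ^ 60 := by ring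
  rw [hE] at hsieve
  linarith

theorem piStar_mul_log_sq_div_le_of_notMem {a α : ℝ} (ha : 0 < a) (haα : a ≤ α) (β : ℝ) {T : ℕ}
    (hT : 2 ≤ T) (hα : α ∉ nearRationals T) :
    (piStar α β ((T ^ 64 : ℕ) : ℝ) : ℝ) * Real.log ((T ^ 64 : ℕ) : ℝ) ^ 2 /
      ((T ^ 64 : ℕ) : ℝ) ≤ 16384 + 4096 * (9 + 1 / a) := by
  have hT1 : (1 : ℝ) ≤ T := by exact_mod_cast (by omega : 1 ≤ T)
  have hT0 : (0 : ℝ) < T := by linarith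
  have hlog : 0 < Real.log T := Real.log_pos (by exact_mod_cast hT)
  have hlogT : Real.log T ≤ T := (Real.log_le_sub_one_of_pos hT0).trans (by linarith)
  have h1 := piStar_le_of_notMem ha haα β hT hα
  push_cast at *
  rw [Real.log_pow, div_le_iff₀ (by positivity)]
  push_cast
  have hp : (T : ℝ) ≤ (T : ℝ) ^ 60 := le_self_pow₀ hT1 (by norm_num)
  have hp1 : (1 : ℝ) ≤ (T : ℝ) ^ 60 := one_le_pow₀ hT1
  have h2 : 7 * (T : ℝ) ^ 60 + (T + T / a + 1) ≤ (9 + 1 / a) * (T : ℝ) ^ 60 := by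
    have : (T : ℝ) / a ≤ 1 / a * (T : ℝ) ^ 60 := by
      rw [one_div, div_eq_inv_mul]; gcongr
    linarith
  calc _ ≤ ((T : ℝ) ^ 64 * (2 / Real.log T) ^ 2 + (9 + 1 / a) * (T : ℝ) ^ 60) *
        (64 * Real.log T) ^ 2 := by
        gcongr
        linarith
    _ = 16384 * (T : ℝ) ^ 64 + (9 + 1 / a) * (T : ℝ) ^ 60 * (64 * Real.log T) ^ 2 := by
        field_simp
        ring
    _ ≤ 16384 * (T : ℝ) ^ 64 + (9 + 1 / a) * (T : ℝ) ^ 60 * (64 * (T : ℝ)) ^ 2 := by gcongr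
    _ = 16384 * (T : ℝ) ^ 64 + 4096 * (9 + 1 / a) * (T : ℝ) ^ 62 := by ring
    _ ≤ 16384 * (T : ℝ) ^ 64 + 4096 * (9 + 1 / a) * (T : ℝ) ^ 64 := by
        gcongr
        norm_num
    _ = _ := by ring

theorem volume_nearRationals_inter_Icc_le {b : ℝ} (hb : 0 ≤ b) {T : ℕ} (hT : 2 ≤ T) :
    volume.real (nearRationals T ∩ Set.Icc 0 b) ≤ 2 * (b + 4) / (T : ℝ) ^ 10 := by
  have hT1 : (1 : ℝ) ≤ T := by exact_mod_cast (by omega : 1 ≤ T)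
  have hT0 : (0 : ℝ) < T := by linarith
  set δ := ((T : ℝ) ^ 46)⁻¹ with hδ
  have hδ0 : 0 ≤ δ := by positivity
  have hδ1 : δ ≤ 1 := inv_le_one_of_one_le₀ (one_le_pow₀ hT1)
  set V : ℕ → Finset ℤ := fun s => Finset.Icc (-(s : ℤ)) ⌊(b + 1) * s⌋ with hV
  have hsub : nearRationals T ∩ Set.Icc 0 b ⊆
      ⋃ s ∈ Finset.Icc 1 (T ^ 18), ⋃ v ∈ V s, Metric.closedBall ((v : ℝ) / s) δ := by
    rintro α ⟨hα, hα0, hαb⟩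
    obtain ⟨s, hs, hsT, v, hv⟩ := mem_nearRationals.1 hα
    simp only [Set.mem_iUnion, Metric.mem_closedBall, Real.dist_eq]
    refine ⟨s, Finset.mem_Icc.2 ⟨hs, hsT⟩, v, ?_, hv⟩
    have hs0 : (0 : ℝ) < s := by exact_mod_cast hs
    rw [abs_le] at hv
    have h1 : -1 ≤ (v : ℝ) / s := by linarith [hv.2]
    have h2 : (v : ℝ) / s ≤ b + 1 := by linarith [hv.1]
    rw [le_div_iff₀ hs0] at h1
    rw [div_le_iff₀ hs0] at h2
    rw [hV, Finset.mem_Icc, Int.le_floor]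
    refine ⟨?_, h2⟩
    have : ((-(s : ℤ) : ℤ) : ℝ) ≤ v := by push_cast; linarith
    exact_mod_cast this
  have hcard : ∀ s ∈ Finset.Icc 1 (T ^ 18), ((V s).card : ℝ) ≤ (b + 4) * (T : ℝ) ^ 18 := by
    intro s hs
    rw [Finset.mem_Icc] at hs
    have hs1 : (1 : ℝ) ≤ s := by exact_mod_cast hs.1
    have hsT : (s : ℝ) ≤ (T : ℝ) ^ 18 := by exact_mod_cast hs.2
    have h0 : (0 : ℤ) ≤ ⌊(b + 1) * s⌋ := Int.floor_nonneg.2 (by positivity)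
    have h1 : (((V s).card : ℕ) : ℤ) = ⌊(b + 1) * s⌋ + 1 + s := by
      rw [hV, Int.card_Icc, Int.toNat_of_nonneg (by omega)]
      ring
    have h2 : ((V s).card : ℝ) = (⌊(b + 1) * s⌋ : ℝ) + 1 + s := by exact_mod_cast h1
    rw [h2]
    have := Int.floor_le ((b + 1) * s)
    nlinarith
  have hfin : volume (⋃ s ∈ Finset.Icc 1 (T ^ 18), ⋃ v ∈ V s,
      Metric.closedBall ((v : ℝ) / s) δ) ≠ ⊤ := by
    refine (Bornology.IsBounded.measure_lt_top ?_).ne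
    refine (Bornology.isBounded_biUnion_finset _).2 fun s _ =>
      (Bornology.isBounded_biUnion_finset _).2 fun v _ => Metric.isBounded_closedBall
  calc _ ≤ volume.real (⋃ s ∈ Finset.Icc 1 (T ^ 18), ⋃ v ∈ V s,
        Metric.closedBall ((v : ℝ) / s) δ) := measureReal_mono hsub hfin
    _ ≤ ∑ s ∈ Finset.Icc 1 (T ^ 18), ∑ v ∈ V s,
        volume.real (Metric.closedBall ((v : ℝ) / s) δ) :=
        (measureReal_biUnion_finset_le _ _).trans
          (Finset.sum_le_sum fun s _ => measureReal_biUnion_finset_le _ _)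
    _ ≤ ∑ s ∈ Finset.Icc 1 (T ^ 18), (b + 4) * (T : ℝ) ^ 18 * (2 * δ) := by
        refine Finset.sum_le_sum fun s hs => ?_
        simp only [Real.volume_real_closedBall hδ0, Finset.sum_const, nsmul_eq_mul]
        gcongr
        exact hcard s hs
    _ = _ := by
        rw [Finset.sum_const, Nat.card_Icc, nsmul_eq_mul, hδ]
        push_cast [Nat.add_sub_cancel]
        field_simp

end SieveBound

section FirstMoment

theorem measurableSet_prime_floor (β : ℝ) (p : ℕ) :
    MeasurableSet {α : ℝ | Nat.Prime (⌊α * p + β⌋).toNat} := by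
  have h : Measurable fun α : ℝ => ⌊α * p + β⌋ := Int.measurable_floor.comp (by fun_prop)
  exact h (MeasurableSet.of_discrete (s := {k : ℤ | Nat.Prime k.toNat}))

theorem piStar_natCast_eq_sum_indicator (α β : ℝ) (N : ℕ) : (piStar α β N : ℝ) =
    ∑ p ∈ Finset.Icc 1 N with p.Prime,
      Set.indicator {α : ℝ | Nat.Prime (⌊α * p + β⌋).toNat} (fun _ => (1 : ℝ)) α := by
  rw [piStar_natCast_eq_card, ← Finset.filter_filter, Finset.card_filter]
  push_cast
  refine Finset.sum_congr rfl fun p _ => ?_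
  simp [Set.indicator]

theorem measurable_piStar_natCast (β : ℝ) (N : ℕ) :
    Measurable fun α : ℝ => (piStar α β N : ℝ) := by
  simp_rw [piStar_natCast_eq_sum_indicator]
  exact Finset.measurable_sum _ fun p _ =>
    measurable_const.indicator (measurableSet_prime_floor β p)

theorem piStar_natCast_le (α β : ℝ) (N : ℕ) : piStar α β N ≤ N := by
  rw [piStar_natCast_eq_card]
  exact (Finset.card_filter_le _ _).trans (by rw [Nat.card_Icc]; omega)

theorem setIntegral_piStar_natCast (β A B : ℝ) (N : ℕ) :
    ∫ α in Set.Icc A B, (piStar α β N : ℝ) = ∑ p ∈ Finset.Icc 1 N with p.Prime,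
      volume.real ({α : ℝ | Nat.Prime (⌊α * p + β⌋).toNat} ∩ Set.Icc A B) := by
  simp_rw [piStar_natCast_eq_sum_indicator]
  have hfin : IsFiniteMeasure (volume.restrict (Set.Icc A B)) := by infer_instance
  rw [integral_finsetSum]
  · refine Finset.sum_congr rfl fun p _ => ?_
    rw [integral_indicator_const _ (measurableSet_prime_floor β p), smul_eq_mul, mul_one,
      measureReal_restrict_apply (measurableSet_prime_floor β p)]
  · intro p _
    exact (integrable_const 1).indicator (measurableSet_prime_floor β p)

theorem primeCounting_sub_le_card (X Y : ℕ) : (Nat.primeCounting Y : ℝ) - Nat.primeCounting X ≤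
    ((Finset.Ioc X Y).filter Nat.Prime).card := by
  rw [sub_le_iff_le_add']
  have h : (Finset.range (Y + 1)).filter Nat.Prime ⊆
      (Finset.range (X + 1)).filter Nat.Prime ∪ (Finset.Ioc X Y).filter Nat.Prime := by
    intro q hq
    simp only [Finset.mem_union, Finset.mem_filter, Finset.mem_range, Finset.mem_Ioc] at hq ⊢
    by_cases h : q ≤ X
    · exact Or.inl ⟨by omega, hq.2⟩
    · exact Or.inr ⟨by omega, hq.2⟩
  have h1 := (Finset.card_le_card h).trans (Finset.card_union_le _ _)
  rw [← Nat.count_eq_card_filter_range, ← Nat.count_eq_card_filter_range] at h1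
  exact_mod_cast h1

theorem primeCounting_sub_div_le_volume (β A B : ℝ) {p : ℕ} (hp : 0 < p) :
    ((Nat.primeCounting ⌊B * p + (β - 1)⌋₊ : ℝ) - Nat.primeCounting ⌊A * p + β⌋₊) / p ≤
      volume.real ({α : ℝ | Nat.Prime (⌊α * p + β⌋).toNat} ∩ Set.Icc A B) := by
  have hp0 : (0 : ℝ) < p := by exact_mod_cast hp
  set Q := (Finset.Ioc ⌊A * p + β⌋₊ ⌊B * p + (β - 1)⌋₊).filter Nat.Prime with hQ
  set I : ℕ → Set ℝ := fun q => Set.Ico ((q - β) / p) ((q + 1 - β) / p) with hI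
  have hmem : ∀ q : ℕ, ∀ α ∈ I q, ⌊α * p + β⌋ = q := by
    rintro q α ⟨h1, h2⟩
    rw [div_le_iff₀ hp0] at h1
    rw [lt_div_iff₀ hp0] at h2
    rw [Int.floor_eq_iff, Int.cast_natCast]
    constructor <;> linarith
  have hdisj : Set.PairwiseDisjoint (Q : Set ℕ) I := by
    intro q _ q' _ hqq'
    refine Set.disjoint_left.2 fun α h1 h2 => hqq' ?_
    have := (hmem q α h1).symm.trans (hmem q' α h2)
    exact_mod_cast this
  have hsub : ⋃ q ∈ Q, I q ⊆ {α : ℝ | Nat.Prime (⌊α * p + β⌋).toNat} ∩ Set.Icc A B := by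
    intro α hα
    simp only [Set.mem_iUnion] at hα
    obtain ⟨q, hq, hαq⟩ := hα
    simp only [hQ, Finset.mem_filter, Finset.mem_Ioc] at hq
    obtain ⟨⟨hq1, hq2⟩, hqp⟩ := hq
    have h1 : A * p + β < q := Nat.lt_of_floor_lt hq1
    have h2 : (q : ℝ) ≤ B * p + (β - 1) := (Nat.le_floor_iff' hqp.ne_zero).1 hq2
    refine ⟨?_, ?_, ?_⟩
    · change Nat.Prime _
      rw [hmem q α hαq, Int.toNat_natCast]
      exact hqp
    · have := hαq.1
      rw [div_le_iff₀ hp0] at this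
      exact le_of_mul_le_mul_right (by linarith) hp0
    · have := hαq.2
      rw [lt_div_iff₀ hp0] at this
      exact le_of_mul_le_mul_right (by linarith) hp0
  have hvol : ∀ q ∈ Q, volume.real (I q) = 1 / p := by
    intro q _
    rw [hI, Real.volume_real_Ico_of_le (by gcongr; linarith)]
    field_simp
    ring
  have hfin : volume ({α : ℝ | Nat.Prime (⌊α * p + β⌋).toNat} ∩ Set.Icc A B) ≠ ⊤ :=
    ((measure_mono Set.inter_subset_right).trans_lt measure_Icc_lt_top).ne
  calc _ ≤ (Q.card : ℝ) / p := by
        gcongr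
        exact primeCounting_sub_le_card _ _
    _ = volume.real (⋃ q ∈ Q, I q) := by
        rw [measureReal_biUnion_finset hdisj (fun _ _ => measurableSet_Ico)
          (fun q _ => measure_Ico_lt_top.ne), Finset.sum_congr rfl hvol, Finset.sum_const,
          nsmul_eq_mul]
        ring
    _ ≤ _ := measureReal_mono hsub hfin

theorem tendsto_log_div_log_affine {c : ℝ} (hc : 0 < c) (d : ℝ) :
    Tendsto (fun x : ℝ => Real.log x / Real.log (c * x + d)) atTop (nhds 1) := by
  have h1 : Tendsto (fun x : ℝ => Real.log (c + d / x) / Real.log x) atTop (nhds 0) := by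
    refine Tendsto.div_atTop (a := Real.log c) ?_ Real.tendsto_log_atTop
    have h2 : Tendsto (fun x : ℝ => c + d / x) atTop (nhds (c + 0)) :=
      tendsto_const_nhds.add (tendsto_const_nhds.div_atTop tendsto_id)
    rw [add_zero] at h2
    exact h2.log hc.ne'
  have h3 : Tendsto (fun x : ℝ => (1 + Real.log (c + d / x) / Real.log x)⁻¹) atTop (nhds 1) := by
    simpa using (h1.const_add 1).inv₀ (by norm_num)
  refine h3.congr' ?_
  have h4 : Tendsto (fun x : ℝ => c * x + d) atTop atTop :=
    tendsto_atTop_add_const_right _ d (tendsto_id.const_mul_atTop hc)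
  filter_upwards [eventually_gt_atTop 1, h4.eventually_gt_atTop 0] with x hx hx'
  have hx0 : 0 < x := by linarith
  have hlog := Real.log_pos hx
  have h5 : c * x + d = x * (c + d / x) := by field_simp
  have h6 : c + d / x ≠ 0 := fun h => by rw [h5, h] at hx'; simp at hx'
  rw [h5, Real.log_mul hx0.ne' h6, one_add_div hlog.ne', inv_div]

theorem tendsto_primeCounting_affine {c : ℝ} (hc : 0 < c) (d : ℝ) :
    Tendsto (fun x : ℝ => (Nat.primeCounting ⌊c * x + d⌋₊ : ℝ) * Real.log x / x) atTop
      (nhds c) := by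
  have h4 : Tendsto (fun x : ℝ => c * x + d) atTop atTop :=
    tendsto_atTop_add_const_right _ d (tendsto_id.const_mul_atTop hc)
  have h1 := tendsto_primeCounting_mul_log_div_self.comp h4
  have h2 : Tendsto (fun x : ℝ => c + d / x) atTop (nhds (c + 0)) :=
    tendsto_const_nhds.add (tendsto_const_nhds.div_atTop tendsto_id)
  have h3 := (h1.mul (tendsto_log_div_log_affine hc d)).mul h2
  rw [one_mul, one_mul, add_zero] at h3
  refine h3.congr' ?_
  filter_upwards [eventually_gt_atTop 0, h4.eventually_gt_atTop 1] with x hx hx'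
  have hlog := Real.log_pos hx'
  have hx0 : 0 < c * x + d := by linarith
  have h5 : c + d / x = (c * x + d) / x := by field_simp
  simp only [Function.comp_apply]
  rw [h5]
  field_simp

theorem eventually_le_volume_prime_floor (β : ℝ) {A B : ℝ} (hA : 0 < A) (hAB : A < B) {c : ℝ}
    (hc : c < B - A) : ∀ᶠ p : ℕ in atTop, c / Real.log p ≤
      volume.real ({α : ℝ | Nat.Prime (⌊α * p + β⌋).toNat} ∩ Set.Icc A B) := by
  have h1 := ((tendsto_primeCounting_affine (hA.trans hAB) (β - 1)).sub
    (tendsto_primeCounting_affine hA β)).comp tendsto_natCast_atTop_atTop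
  filter_upwards [h1.eventually_const_lt hc, eventually_gt_atTop 1] with p hp hp1
  have hp0 : (0 : ℝ) < p := by exact_mod_cast (by omega : 0 < p)
  have hlog : 0 < Real.log p := Real.log_pos (by exact_mod_cast hp1)
  refine le_trans ?_ (primeCounting_sub_div_le_volume β A B (by omega))
  simp only [Function.comp_apply] at hp
  rw [div_le_iff₀ hlog]
  refine hp.le.trans (le_of_eq ?_)
  ring

theorem eventually_le_setIntegral_piStar (β : ℝ) {A B : ℝ} (hA : 0 < A) (hAB : A < B) {c : ℝ}
    (hc : c < B - A) : ∀ᶠ N : ℕ in atTop, c ≤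
      ∫ α in Set.Icc A B, (piStar α β N : ℝ) * Real.log N ^ 2 / N := by
  obtain ⟨c₁, hc₁, hc₁'⟩ := exists_between (max_lt hc (sub_pos.2 hAB))
  rw [max_lt_iff] at hc₁
  obtain ⟨P, hP⟩ := eventually_atTop.1 (eventually_le_volume_prime_floor β hA hAB hc₁')
  have h1 : Tendsto (fun N : ℕ => ((Nat.primeCounting N : ℝ) * Real.log N / N -
      (Nat.primeCounting P : ℝ) * (Real.log N / N)) * c₁) atTop 
      (nhds ((1 - (Nat.primeCounting P : ℝ) * 0) * c₁)) := by
    refine Tendsto.mul_const _ (Tendsto.sub ?_ (Tendsto.const_mul _ ?_))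
    · simpa [Function.comp_def] using
        tendsto_primeCounting_mul_log_div_self.comp (tendsto_natCast_atTop_atTop (R := ℝ))
    · have := (Real.isLittleO_log_id_atTop.tendsto_div_nhds_zero).comp
        (tendsto_natCast_atTop_atTop (R := ℝ))
      exact this
  rw [mul_zero, sub_zero, one_mul] at h1
  filter_upwards [h1.eventually_const_lt hc₁.1, eventually_gt_atTop 1] with N hN hN1
  have hN0 : (0 : ℝ) < N := by exact_mod_cast (by omega : 0 < N)
  have hlog : 0 < Real.log N := Real.log_pos (by exact_mod_cast hN1)
  simp_rw [mul_div_assoc]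
  rw [integral_mul_const, setIntegral_piStar_natCast]
  have h2 : ((Nat.primeCounting N : ℝ) - Nat.primeCounting P) * (c₁ / Real.log N) ≤
      ∑ p ∈ Finset.Icc 1 N with p.Prime,
        volume.real ({α : ℝ | Nat.Prime (⌊α * p + β⌋).toNat} ∩ Set.Icc A B) := by
    calc _ ≤ (((Finset.Ioc P N).filter Nat.Prime).card : ℝ) * (c₁ / Real.log N) := by
          have := hc₁.2
          gcongr
          exact primeCounting_sub_le_card _ _
      _ = ∑ p ∈ Finset.Ioc P N with p.Prime, c₁ / Real.log N := by
          rw [Finset.sum_const, nsmul_eq_mul]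
      _ ≤ ∑ p ∈ Finset.Ioc P N with p.Prime,
        volume.real ({α : ℝ | Nat.Prime (⌊α * p + β⌋).toNat} ∩ Set.Icc A B) := by
          refine Finset.sum_le_sum fun p hp => ?_
          simp only [Finset.mem_filter, Finset.mem_Ioc] at hp
          refine le_trans ?_ (hP p hp.1.1.le)
          have hp1 : (1 : ℝ) < p := by exact_mod_cast hp.2.one_lt
          have hpN : (p : ℝ) ≤ N := by exact_mod_cast hp.1.2
          have := Real.log_pos hp1
          have := hc₁.2
          gcongr
      _ ≤ _ := by
          refine Finset.sum_le_sum_of_subset_of_nonneg ?_ fun _ _ _ => measureReal_nonneg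
          refine Finset.filter_subset_filter _ fun p hp => ?_
          rw [Finset.mem_Ioc] at hp
          exact Finset.mem_Icc.2 ⟨by omega, hp.2⟩
  calc c ≤ _ := hN.le
    _ = ((Nat.primeCounting N : ℝ) - Nat.primeCounting P) * (c₁ / Real.log N) *
        (Real.log N ^ 2 / N) := by
        field_simp
    _ ≤ _ := by gcongr

end FirstMoment

section DensityPoint

/-- The slopes `α` for which `π*(N) (log N)² / N` stays at most `r` for all integers `N ≥ M`. -/
def sparseSlopes (β r : ℝ) (M : ℕ) : Set ℝ :=
  {α | ∀ N : ℕ, M ≤ N → (piStar α β N : ℝ) * Real.log N ^ 2 / N ≤ r}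

theorem measurableSet_sparseSlopes (β r : ℝ) (M : ℕ) : MeasurableSet (sparseSlopes β r M) := by
  have : sparseSlopes β r M = ⋂ N : ℕ, ⋂ _ : M ≤ N,
      {α | (piStar α β N : ℝ) * Real.log N ^ 2 / N ≤ r} := by
    ext α
    simp [sparseSlopes]
  rw [this]
  exact MeasurableSet.iInter fun N => MeasurableSet.iInter fun _ =>
    measurableSet_le (((measurable_piStar_natCast β N).mul_const _).div_const _) measurable_const

theorem tendsto_log_sq_mul_volume_nearRationals (b : ℝ) :
    Tendsto (fun T : ℕ => Real.log ((T ^ 64 : ℕ) : ℝ) ^ 2 * (2 * (b + 4) / (T : ℝ) ^ 10)) atTop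
      (nhds 0) := by
  have h1 : Tendsto (fun T : ℕ => 8192 * (b + 4) *
      ((Real.log T / T) ^ 2 * ((T : ℝ)⁻¹) ^ 8)) atTop
      (nhds (8192 * (b + 4) * (0 ^ 2 * 0 ^ 8))) := by
    refine Tendsto.const_mul _ (Tendsto.mul (Tendsto.pow ?_ 2) (Tendsto.pow ?_ 8))
    · exact (Real.isLittleO_log_id_atTop.tendsto_div_nhds_zero).comp
        (tendsto_natCast_atTop_atTop (R := ℝ))
    · exact tendsto_inv_atTop_nhds_zero_nat
  simp only [ne_eq, OfNat.ofNat_ne_zero, not_false_eq_true, zero_pow, mul_zero] at h1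
  refine h1.congr' ?_
  filter_upwards [eventually_gt_atTop 0] with T hT
  have hT0 : (0 : ℝ) < T := by exact_mod_cast hT
  push_cast
  rw [Real.log_pow]
  push_cast
  field_simp
  ring

theorem le_volume_add_volume_diff_sparseSlopes {A B a β r : ℝ} (ha : 0 < a) (haA : a ≤ A)
    (hAB : A < B) (hr : 0 ≤ r) (M : ℕ) :
    B - A ≤ r * (B - A) + (16384 + 4096 * (9 + 1 / a)) *
      volume.real (Set.Icc A B \ sparseSlopes β r M) := by
  set J := Set.Icc A B with hJ
  set S := sparseSlopes β r M with hSdef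
  have hS : MeasurableSet S := measurableSet_sparseSlopes β r M
  set C := 16384 + 4096 * (9 + 1 / a) with hC
  have hC0 : 0 ≤ C := by positivity
  have hA : 0 < A := ha.trans_le haA
  have hB : 0 ≤ B := by linarith
  have hJm : MeasurableSet J := measurableSet_Icc
  have hJvol : volume.real J = B - A := Real.volume_real_Icc_of_le hAB.le
  have hpow : Tendsto (fun T : ℕ => T ^ 64) atTop atTop := tendsto_pow_atTop (by norm_num)
  refine le_of_forall_lt fun c hc => ?_
  obtain ⟨c', hcc', hc'⟩ := exists_between hc
  refine hcc'.trans_le ?_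
  have hlim := (tendsto_log_sq_mul_volume_nearRationals B).const_add
    (r * (B - A) + C * volume.real (J \ S))
  rw [add_zero] at hlim
  refine ge_of_tendsto hlim ?_
  filter_upwards [hpow.eventually (eventually_le_setIntegral_piStar β hA hAB hc'),
    hpow.eventually_ge_atTop M, eventually_ge_atTop 2] with T hT hTM hT2
  refine hT.trans ?_
  set N := T ^ 64 with hN
  set E := nearRationals T
  have hE : MeasurableSet E := measurableSet_nearRationals T
  have hN0 : (0 : ℝ) < N := by
    rw [hN]; exact_mod_cast Nat.pow_pos (n := 64) (by omega : 0 < T)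
  have hfinite : IsFiniteMeasure (volume.restrict J) := by infer_instance
  have hpt : ∀ α ∈ J, (piStar α β N : ℝ) * Real.log N ^ 2 / N ≤
      r + Sᶜ.indicator (fun _ => C) α + E.indicator (fun _ => Real.log N ^ 2) α := by
    intro α hα
    have h1 : 0 ≤ Sᶜ.indicator (fun _ => C) α := Set.indicator_nonneg (fun _ _ => hC0) α
    have h2 : 0 ≤ E.indicator (fun _ => Real.log (N : ℝ) ^ 2) α :=
      Set.indicator_nonneg (fun _ _ => sq_nonneg _) α
    by_cases hαS : α ∈ S
    · have := hαS N hTM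
      linarith
    · by_cases hαE : α ∈ E
      · rw [Set.indicator_of_mem hαE]
        have h3 : (piStar α β N : ℝ) ≤ N := by exact_mod_cast piStar_natCast_le α β N
        have h4 : (piStar α β N : ℝ) * Real.log N ^ 2 / N ≤ Real.log N ^ 2 := by
          rw [div_le_iff₀ hN0, mul_comm]
          gcongr
        linarith
      · rw [Set.indicator_of_mem (show α ∈ Sᶜ from hαS)]
        have := piStar_mul_log_sq_div_le_of_notMem ha (haA.trans hα.1) β hT2 hαE
        linarith
  have hint1 : IntegrableOn (fun _ : ℝ => r) J := integrable_const r
  have hint2 : IntegrableOn (Sᶜ.indicator fun _ : ℝ => C) J :=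
    (integrable_const C).indicator hS.compl
  have hint3 : IntegrableOn (E.indicator fun _ : ℝ => Real.log (N : ℝ) ^ 2) J :=
    (integrable_const _).indicator hE
  have hint4 : IntegrableOn (fun α => r + Sᶜ.indicator (fun _ => C) α) J := hint1.add hint2
  have hint5 : IntegrableOn (fun α : ℝ => (piStar α β N : ℝ) * Real.log N ^ 2 / N) J := by
    refine Integrable.mono' (hint4.add hint3) (((measurable_piStar_natCast β N).mul_const
      _).div_const _).aestronglyMeasurable ?_
    filter_upwards [ae_restrict_mem hJm] with α hα
    rw [Real.norm_of_nonneg (by positivity)]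
    exact hpt α hα
  calc _ ≤ ∫ α in J, (r + Sᶜ.indicator (fun _ => C) α +
        E.indicator (fun _ => Real.log (N : ℝ) ^ 2) α) :=
        setIntegral_mono_on hint5 (hint4.add hint3) hJm hpt
    _ = r * (B - A) + C * volume.real (J \ S) +
        Real.log (N : ℝ) ^ 2 * volume.real (E ∩ J) := by
        rw [integral_add hint4 hint3, integral_add hint1 hint2, setIntegral_const,
          integral_indicator_const _ hS.compl, integral_indicator_const _ hE,
          measureReal_restrict_apply hS.compl, measureReal_restrict_apply hE, hJvol,
          Set.inter_comm Sᶜ, ← Set.sdiff_eq]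
        simp only [smul_eq_mul]
        ring
    _ ≤ _ := by
        have hvol : volume.real (E ∩ J) ≤ 2 * (B + 4) / (T : ℝ) ^ 10 := by
          refine le_trans (measureReal_mono ?_ ?_) (volume_nearRationals_inter_Icc_le hB hT2)
          · exact Set.inter_subset_inter_right _ (Set.Icc_subset_Icc hA.le le_rfl)
          · exact ((measure_mono Set.inter_subset_right).trans_lt measure_Icc_lt_top).ne
        gcongr

theorem volume_sparseSlopes_inter_Ioi (β : ℝ) {r a : ℝ} (hr : 0 ≤ r) (hr1 : r < 1)
    (ha : 0 < a) (M : ℕ) : volume (sparseSlopes β r M ∩ Set.Ioi a) = 0 := by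
  set S := sparseSlopes β r M with hSdef
  have hS : MeasurableSet S := measurableSet_sparseSlopes β r M
  set S' := S ∩ Set.Ioi a with hS'def
  have hS' : MeasurableSet S' := hS.inter measurableSet_Ioi
  set C := 16384 + 4096 * (9 + 1 / a) with hC
  have hC0 : 0 < C := by positivity
  have hfalse : ∀ᵐ x ∂volume.restrict S', False := by
    filter_upwards [Besicovitch.ae_tendsto_measure_inter_div volume S', ae_restrict_mem hS']
      with x hx hxS
    have hxa : a < x := hxS.2
    set δ := (1 - r) / (2 * C) with hδ
    have hδ0 : 0 < δ := div_pos (by linarith) (by positivity)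
    have hx' := (ENNReal.tendsto_toReal ENNReal.one_ne_top).comp hx
    have hev := hx'.eventually_const_lt (show 1 - δ < ENNReal.toReal 1 by simpa using hδ0)
    have hsmall : ∀ᶠ ρ : ℝ in nhdsWithin 0 (Set.Ioi 0), ρ < x - a :=
      nhdsWithin_le_nhds (eventually_lt_nhds (by linarith))
    have hself : ∀ᶠ ρ : ℝ in nhdsWithin 0 (Set.Ioi 0), ρ ∈ Set.Ioi (0 : ℝ) := self_mem_nhdsWithin
    obtain ⟨ρ, h1, h2, hρ⟩ := (hev.and (hsmall.and hself)).exists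
    rw [Set.mem_Ioi] at hρ
    simp only [Function.comp_apply, ENNReal.toReal_div] at h1
    change 1 - δ < volume.real (S' ∩ Metric.closedBall x ρ) /
      volume.real (Metric.closedBall x ρ) at h1
    rw [Real.volume_real_closedBall hρ.le, Real.closedBall_eq_Icc,
      lt_div_iff₀ (by positivity)] at h1
    have h3 := le_volume_add_volume_diff_sparseSlopes (β := β) ha
      (show a ≤ x - ρ by linarith) (show x - ρ < x + ρ by linarith) hr M
    have h4 : volume.real (Set.Icc (x - ρ) (x + ρ) \ S) ≤
        2 * ρ - volume.real (S' ∩ Set.Icc (x - ρ) (x + ρ)) := by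
      have h5 := measureReal_inter_add_sdiff₀ (μ := volume) (s := Set.Icc (x - ρ) (x + ρ))
        hS'.nullMeasurableSet measure_Icc_lt_top.ne
      rw [Real.volume_real_Icc_of_le (by linarith), Set.inter_comm] at h5
      have h6 : volume.real (Set.Icc (x - ρ) (x + ρ) \ S) ≤
          volume.real (Set.Icc (x - ρ) (x + ρ) \ S') :=
        measureReal_mono (Set.sdiff_subset_sdiff_right Set.inter_subset_left)
          ((measure_mono Set.sdiff_subset).trans_lt measure_Icc_lt_top).ne
      linarith
    have h7 : C * volume.real (Set.Icc (x - ρ) (x + ρ) \ S) ≤ C * (δ * (2 * ρ)) := by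
      gcongr
      linarith
    have h8 : C * (δ * (2 * ρ)) = (1 - r) * ρ := by
      rw [hδ]; field_simp
    have h9 : 0 < (1 - r) * ρ := mul_pos (by linarith) hρ
    linarith
  rw [ae_iff] at hfalse
  simpa using hfalse

end DensityPoint

theorem primes_in_beatty_ae (β : ℝ) :
    ∀ᵐ α ∂(volume.restrict (Set.Ioi (0 : ℝ))),
      (1 : EReal) ≤
        Filter.limsup
          (fun x : ℝ => (((piStar α β x : ℝ) * (Real.log x) ^ 2 / x : ℝ) : EReal))
          Filter.atTop := by
  rw [ae_restrict_iff' measurableSet_Ioi]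
  have hnull : ∀ (r : ℚ) (M k : ℕ), 0 ≤ r → r < 1 →
      ∀ᵐ α : ℝ, α ∉ sparseSlopes β r M ∩ Set.Ioi (1 / (k + 1 : ℝ)) := by
    intro r M k hr hr1
    exact measure_eq_zero_iff_ae_notMem.1 (volume_sparseSlopes_inter_Ioi β
      (by exact_mod_cast hr) (by exact_mod_cast hr1) (by positivity) M)
  have hall : ∀ᵐ α : ℝ, ∀ (r : ℚ) (M k : ℕ), 0 ≤ r → r < 1 →
      α ∉ sparseSlopes β r M ∩ Set.Ioi (1 / (k + 1 : ℝ)) := by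
    simp only [ae_all_iff]
    exact hnull
  filter_upwards [hall] with α hα hα0
  by_contra! hlim
  obtain ⟨r, hr, hr1⟩ := EReal.lt_iff_exists_rat_btwn.1
    (max_lt hlim (zero_lt_one' EReal))
  rw [max_lt_iff] at hr
  have hr0 : (0 : ℝ) < r := by exact_mod_cast hr.2
  have hr1' : (r : ℝ) < 1 := by exact_mod_cast hr1
  obtain ⟨X, hX⟩ := eventually_atTop.1 (eventually_lt_of_limsup_lt hr.1)
  obtain ⟨k, hk⟩ := exists_nat_one_div_lt (show (0 : ℝ) < α from hα0)
  refine hα r ⌈X⌉₊ k (by exact_mod_cast hr0.le) (by exact_mod_cast hr1') ⟨fun N hN => ?_, hk⟩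
  have := hX N (Nat.ceil_le.1 hN)
  exact (EReal.coe_lt_coe_iff.1 this).le
end

section
/- There exist absolute constants c₁, c₂ > 0 with the following property. Let b₂ > b₁ > 0 and β be real numbers and let ε ∈ (0, 1/12). Then there exists x₀ (depending on b₁, b₂, β, ε) such that for every integer x ≥ x₀ there is a Lebesgue-measurable exceptional set J_E ⊆ (b₁,b₂) with mes(J_E) ≤ c₁·x^{−ε}, such that for every squarefree positive integer d ≤ x^{1/3−2ε} and every irrational α ∈ (b₁,b₂)∖J_E one has |#{1 ≤ n ≤ x : d divides n·⌊αn+β⌋} − (x/d)·∏_{p∣d}(2 − 1/p)| ≤ c₂·x^{1−ε}/d, where the product runs over the prime divisors p of d. -/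
open MeasureTheory

/-- A full period of an orbit `k ↦ kθ + c`, where `a / q` is a close rational approximation of `θ`,
visits the arc `[0, δ)` of the circle at most `qδ + 3` times. -/
lemma card_filter_fract_lt_of_period {θ : ℝ} {a : ℤ} {q : ℕ} (hq : 0 < q)
    (hcop : IsCoprime (q : ℤ) a) (hθ : |q * θ - a| ≤ 1 / q) (c : ℝ) {δ : ℝ} (hδ : 0 ≤ δ) :
    ((((Finset.range q).filter fun k : ℕ => Int.fract (k * θ + c) < δ).card : ℕ) : ℝ)
      ≤ q * δ + 3 := by
  have hq' : (0 : ℝ) < q := by exact_mod_cast hq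
  set J : ℕ → ℤ := fun k => k * a - q * ⌊k * θ + c⌋ with hJ
  have hmaps : ∀ k ∈ (Finset.range q).filter fun k : ℕ => Int.fract (k * θ + c) < δ,
      J k ∈ Finset.Icc ⌈-q * c - 1⌉ ⌊q * δ - q * c + 1⌋ := by
    intro k hk
    simp only [Finset.mem_filter, Finset.mem_range] at hk
    obtain ⟨hkq, hkδ⟩ := hk
    have hkq' : (k : ℝ) ≤ q := by exact_mod_cast hkq.le
    have hr : |(k : ℝ) * (q * θ - a)| ≤ 1 := by
      rw [abs_mul, Nat.abs_cast]
      calc (k : ℝ) * |q * θ - a| ≤ q * (1 / q) := by gcongr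
        _ = 1 := by field_simp
    have h0 := Int.fract_nonneg ((k : ℝ) * θ + c)
    rw [Int.fract] at h0 hkδ
    have h1 := mul_nonneg hq'.le h0
    have h2 := mul_lt_mul_of_pos_left hkδ hq'
    rw [abs_le] at hr
    rw [Finset.mem_Icc, Int.ceil_le, Int.le_floor]
    simp only [hJ]
    push_cast
    constructor <;> nlinarith
  have hinj : Set.InjOn J ((Finset.range q).filter fun k : ℕ => Int.fract (k * θ + c) < δ) := by
    intro k hk l hl hkl
    simp only [Finset.coe_filter, Finset.mem_range, Set.mem_ofPred_eq] at hk hl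
    have hdvd : (q : ℤ) ∣ (k - l) * a :=
      ⟨⌊k * θ + c⌋ - ⌊l * θ + c⌋, by simp only [hJ] at hkl; linarith⟩
    have hkl' := Int.eq_zero_of_abs_lt_dvd (hcop.dvd_of_dvd_mul_right hdvd)
      (by rw [abs_lt]; omega)
    omega
  have hcard := Finset.card_le_card_of_injOn J hmaps hinj
  rw [Int.card_Icc] at hcard
  refine (Nat.cast_le.mpr hcard).trans ?_
  have hpos : 0 ≤ q * δ + 3 := by positivity
  rw [← Int.cast_natCast, Int.toNat_eq_max]
  push_cast
  refine max_le ?_ hpos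
  have h1 := Int.floor_le (q * δ - q * c + 1)
  have h2 := Int.le_ceil (-q * c - 1)
  linarith

lemma card_filter_fract_lt_of_periods {θ : ℝ} {a : ℤ} {q : ℕ} (hq : 0 < q)
    (hcop : IsCoprime (q : ℤ) a) (hθ : |q * θ - a| ≤ 1 / q) (c : ℝ) {δ : ℝ} (hδ : 0 ≤ δ) (m : ℕ) :
    ((((Finset.range (m * q)).filter fun k : ℕ => Int.fract (k * θ + c) < δ).card : ℕ) : ℝ)
      ≤ m * (q * δ + 3) := by
  induction m with
  | zero => simp
  | succ m ih =>
    have hsum : ((Finset.range ((m + 1) * q)).filter fun k : ℕ => Int.fract (k * θ + c) < δ).card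
        = ((Finset.range (m * q)).filter fun k : ℕ => Int.fract (k * θ + c) < δ).card
          + ((Finset.range q).filter fun k : ℕ =>
              Int.fract (k * θ + (((m * q : ℕ) : ℝ) * θ + c)) < δ).card := by
      simp only [Finset.card_filter]
      rw [add_mul, one_mul, Finset.sum_range_add]
      congr 1
      refine Finset.sum_congr rfl fun k _ => ?_
      rw [show (((m * q + k : ℕ) : ℝ)) * θ + c = k * θ + (((m * q : ℕ) : ℝ) * θ + c) by
        push_cast; ring]
    rw [hsum, Nat.cast_add, Nat.cast_succ]
    have := card_filter_fract_lt_of_period hq hcop hθ (((m * q : ℕ) : ℝ) * θ + c) hδ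
    linarith

lemma card_filter_fract_lt_le {θ : ℝ} {a : ℤ} {q : ℕ} (hq : 0 < q)
    (hcop : IsCoprime (q : ℤ) a) (hθ : |q * θ - a| ≤ 1 / q) (c : ℝ) {δ : ℝ} (hδ : 0 ≤ δ)
    (hδ1 : δ ≤ 1) (N : ℕ) :
    ((((Finset.range N).filter fun k : ℕ => Int.fract (k * θ + c) < δ).card : ℕ) : ℝ)
      ≤ N * δ + (3 * N / q + q + 3) := by
  have hq' : (0 : ℝ) < q := by exact_mod_cast hq
  have hsub : N ≤ (N / q + 1) * q := by
    have := Nat.lt_div_mul_add hq (a := N)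
    rw [add_mul, one_mul]; omega
  have hmono : ((Finset.range N).filter fun k : ℕ => Int.fract (k * θ + c) < δ).card
      ≤ ((Finset.range ((N / q + 1) * q)).filter fun k : ℕ => Int.fract (k * θ + c) < δ).card :=
    Finset.card_le_card (Finset.filter_subset_filter _ (Finset.range_mono hsub))
  have h1 := card_filter_fract_lt_of_periods hq hcop hθ c hδ (N / q + 1)
  have h2 : ((N / q : ℕ) : ℝ) ≤ N / q := Nat.cast_div_le
  calc _ ≤ _ := Nat.cast_le.mpr hmono
    _ ≤ _ := h1
    _ ≤ (N / q + 1 : ℝ) * (q * δ + 3) := by push_cast; gcongr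
    _ = N * δ + (3 * N / q + q * δ + 3) := by field_simp; ring
    _ ≤ _ := by nlinarith

/-- Discrepancy of the orbit `k ↦ kθ + c` for the arc `[0, δ)`, in terms of the denominator of a
rational approximation of `θ`. -/
lemma abs_card_filter_fract_lt_sub_le {θ : ℝ} {a : ℤ} {q : ℕ} (hq : 0 < q)
    (hcop : IsCoprime (q : ℤ) a) (hθ : |q * θ - a| ≤ 1 / q) (c : ℝ) {δ : ℝ} (hδ : 0 ≤ δ)
    (hδ1 : δ ≤ 1) (N : ℕ) :
    |((((Finset.range N).filter fun k : ℕ => Int.fract (k * θ + c) < δ).card : ℕ) : ℝ) - N * δ|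
      ≤ 3 * N / q + q + 3 := by
  have h1 := card_filter_fract_lt_le hq hcop hθ c hδ hδ1 N
  have h2 := card_filter_fract_lt_le hq hcop hθ (c - δ) (sub_nonneg.mpr hδ1) (by linarith) N
  have hsub : ((Finset.range N).filter fun k : ℕ => ¬ Int.fract (k * θ + c) < δ) ⊆
      (Finset.range N).filter fun k : ℕ => Int.fract (k * θ + (c - δ)) < 1 - δ := by
    intro k hk
    simp only [Finset.mem_filter, not_lt] at hk ⊢
    refine ⟨hk.1, ?_⟩
    have h3 := Int.fract_lt_one ((k : ℝ) * θ + c)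
    have h4 : (k : ℝ) * θ + (c - δ) = (Int.fract (k * θ + c) - δ) + ⌊(k : ℝ) * θ + c⌋ := by
      rw [Int.fract]; ring
    rw [h4, Int.fract_add_intCast, Int.fract_eq_self.mpr ⟨by linarith, by linarith⟩]
    linarith
  have hadd := Finset.card_filter_add_card_filter_not (s := Finset.range N)
    (fun k : ℕ => Int.fract (k * θ + c) < δ)
  rw [Finset.card_range] at hadd
  have hadd' := congrArg (Nat.cast (R := ℝ)) hadd
  have hle : ((Finset.card _ : ℕ) : ℝ) ≤ _ := Nat.cast_le.mpr (Finset.card_le_card hsub)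
  push_cast at hadd'
  rw [abs_le]
  constructor <;> linarith

lemma natCast_dvd_floor_iff {v : ℕ} (hv : 0 < v) (y : ℝ) :
    (v : ℤ) ∣ ⌊y⌋ ↔ Int.fract (y / v) < 1 / v := by
  have hv' : (0 : ℝ) < v := by exact_mod_cast hv
  rw [Int.fract, lt_div_iff₀ hv', sub_mul, div_mul_cancel₀ _ hv'.ne']
  constructor
  · rintro ⟨w, hw⟩
    have hw' : (⌊y⌋ : ℝ) = v * w := by exact_mod_cast hw
    have h1 := Int.floor_le y
    have h2 := Int.lt_floor_add_one y
    have h3 : w ≤ ⌊y / v⌋ := by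
      rw [Int.le_floor, le_div_iff₀ hv']; linarith
    have h4 : (w : ℝ) ≤ ⌊y / v⌋ := by exact_mod_cast h3
    nlinarith
  · intro h
    refine ⟨⌊y / v⌋, ?_⟩
    have h1 := Int.floor_le (y / v)
    rw [le_div_iff₀ hv'] at h1
    rw [Int.floor_eq_iff]
    push_cast
    constructor <;> linarith

lemma abs_card_dvd_dvd_floor_sub_le {u v x : ℕ} (hu : 0 < u) (hv : 0 < v) {α T Q : ℝ} (β : ℝ)
    (hT : 1 ≤ T) (hx : x ≤ Q * T)
    (hα : ∀ q : ℕ, 0 < q → q ≤ Q → ∀ a : ℤ, 1 / T < |q * u / v * α - a|) :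
    |((((Finset.Icc 1 x).filter fun n : ℕ => (u : ℤ) ∣ n ∧ (v : ℤ) ∣ ⌊α * n + β⌋).card : ℕ) : ℝ)
      - x / (u * v)| ≤ 8 * T := by
  have hu' : (0 : ℝ) < u := by exact_mod_cast hu
  have hv' : (0 : ℝ) < v := by exact_mod_cast hv
  have hv1 : (1 : ℝ) ≤ v := by exact_mod_cast hv
  have hu1 : (1 : ℝ) ≤ u := by exact_mod_cast hu
  set θ : ℝ := α * u / v with hθ
  set c : ℝ := (α * u + β) / v with hc
  set N : ℕ := x / u with hN
  have hcard : ((Finset.Icc 1 x).filter fun n : ℕ => (u : ℤ) ∣ n ∧ (v : ℤ) ∣ ⌊α * n + β⌋).card =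
      ((Finset.range N).filter fun k : ℕ => Int.fract (k * θ + c) < 1 / v).card := by
    symm
    refine Finset.card_bij (fun k _ => u * (k + 1)) ?_ ?_ ?_
    · intro k hk
      simp only [Finset.mem_filter, Finset.mem_range, Finset.mem_Icc] at hk ⊢
      refine ⟨⟨Nat.mul_pos hu k.succ_pos, ?_⟩, ⟨k + 1, by push_cast; ring⟩, ?_⟩
      · exact (Nat.mul_le_mul_left u hk.1).trans (Nat.mul_div_le x u)
      · rw [natCast_dvd_floor_iff hv]
        convert hk.2 using 2
        rw [hθ, hc]
        push_cast
        ring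
    · intro k _ l _ h
      have := Nat.eq_of_mul_eq_mul_left hu h
      omega
    · intro n hn
      simp only [Finset.mem_filter, Finset.mem_Icc] at hn
      obtain ⟨⟨hn1, hnx⟩, hun, hvn⟩ := hn
      obtain ⟨m, rfl⟩ := Int.natCast_dvd_natCast.mp hun
      obtain ⟨k, rfl⟩ : ∃ k, m = k + 1 := Nat.exists_eq_succ_of_ne_zero (by rintro rfl; simp at hn1)
      refine ⟨k, ?_, rfl⟩
      simp only [Finset.mem_filter, Finset.mem_range]
      refine ⟨(Nat.le_div_iff_mul_le hu).mpr (by linarith), ?_⟩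
      rw [natCast_dvd_floor_iff hv] at hvn
      convert hvn using 2
      rw [hθ, hc]
      push_cast
      ring
  have hn0 : 0 < ⌊T⌋₊ := Nat.floor_pos.mpr hT
  obtain ⟨r, hr, hrT⟩ := Real.exists_rat_abs_sub_le_and_den_le θ hn0
  have hq : 0 < r.den := r.pos
  have hq' : (0 : ℝ) < r.den := by exact_mod_cast hq
  have hcop : IsCoprime (r.den : ℤ) r.num := by
    rw [Int.isCoprime_iff_gcd_eq_one, Int.gcd_comm]
    exact r.reduced
  have happrox : |r.den * θ - r.num| ≤ 1 / (⌊T⌋₊ + 1) := by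
    have h1 : (r.den : ℝ) * θ - r.num = r.den * (θ - r) := by
      rw [mul_sub]
      congr 1
      rw [Rat.cast_def]
      field_simp
    rw [h1, abs_mul, Nat.abs_cast]
    calc (r.den : ℝ) * |θ - r| ≤ r.den * (1 / ((⌊T⌋₊ + 1) * r.den)) := by gcongr
      _ = 1 / (⌊T⌋₊ + 1) := by field_simp
  have hrT' : (r.den : ℝ) ≤ ⌊T⌋₊ := by exact_mod_cast hrT
  have hqT : (r.den : ℝ) ≤ T := hrT'.trans (Nat.floor_le (by linarith))
  have hqQ : Q < r.den := by
    by_contra! h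
    have h1 := hα r.den hq h r.num
    rw [show (r.den : ℝ) * u / v * α = r.den * θ by rw [hθ]; ring] at h1
    have h2 : (1 : ℝ) / (⌊T⌋₊ + 1) ≤ 1 / T :=
      one_div_le_one_div_of_le (by linarith) (Nat.lt_floor_add_one T).le
    linarith
  have hdisc := abs_card_filter_fract_lt_sub_le hq hcop
    (happrox.trans (one_div_le_one_div_of_le hq' (by linarith))) c (δ := 1 / v) (by positivity)
    (by rw [div_le_one hv']; exact hv1) N
  have hNx : (N : ℝ) ≤ x / u := Nat.cast_div_le
  have hNx' : (x : ℝ) / u ≤ N + 1 := by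
    rw [div_le_iff₀ hu']
    have h2 : x ≤ (N + 1) * u := by
      rw [add_mul, one_mul]
      exact (Nat.lt_div_mul_add hu).le
    exact_mod_cast h2
  have hNq : 3 * (N : ℝ) / r.den ≤ 3 * T := by
    rw [div_le_iff₀ hq']
    have h1 : (x : ℝ) / u ≤ x := div_le_self (by positivity) hu1
    nlinarith
  have hmain : |(N : ℝ) * (1 / v) - x / (u * v)| ≤ 1 := by
    have h1 : (N : ℝ) * (1 / v) - x / (u * v) = (N - x / u) * (1 / v) := by field_simp
    rw [h1, abs_mul]
    have h2 : |(N : ℝ) - x / u| ≤ 1 := by rw [abs_le]; constructor <;> linarith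
    have h3 : |(1 : ℝ) / v| ≤ 1 := by
      rw [abs_of_pos (by positivity), div_le_one hv']; exact hv1
    exact mul_le_one₀ h2 (abs_nonneg _) h3
  rw [hcard]
  refine (abs_sub_le _ _ _).trans ((add_le_add hdisc hmain).trans ?_)
  linarith

lemma volume_biUnion_finset_le_ofReal {ι : Type*} (s : Finset ι) (f : ι → Set ℝ) {c C : ℝ}
    (hc : 0 ≤ c) (hC : s.card ≤ C) (hf : ∀ i ∈ s, volume (f i) ≤ ENNReal.ofReal c) :
    volume (⋃ i ∈ s, f i) ≤ ENNReal.ofReal (C * c) := by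
  calc volume (⋃ i ∈ s, f i) ≤ ∑ i ∈ s, volume (f i) := measure_biUnion_finset_le s f
    _ ≤ s.card • ENNReal.ofReal c := Finset.sum_le_card_nsmul _ _ _ hf
    _ = ENNReal.ofReal (s.card * c) := by
      rw [nsmul_eq_mul, ENNReal.ofReal_mul (by positivity), ENNReal.ofReal_natCast]
    _ ≤ ENNReal.ofReal (C * c) := ENNReal.ofReal_le_ofReal (by gcongr)

/-- The points `α` of `(b₁, b₂)` for which `sα` lies within `τ` of an integer. -/
def nearInteger (b₁ b₂ τ s : ℝ) : Set ℝ := Set.Ioo b₁ b₂ ∩ ⋃ a : ℤ, {α | |s * α - a| ≤ τ}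

lemma measurableSet_nearInteger (b₁ b₂ τ s : ℝ) : MeasurableSet (nearInteger b₁ b₂ τ s) := by
  refine measurableSet_Ioo.inter (MeasurableSet.iUnion fun a => ?_)
  exact (isClosed_le (by fun_prop) continuous_const).measurableSet

lemma volume_nearInteger_le {b₁ b₂ τ s : ℝ} (hb₂ : b₁ < b₂) (hs : 0 < s) (hτ : 0 ≤ τ)
    (hτs : τ < s * b₁) : volume (nearInteger b₁ b₂ τ s) ≤ ENNReal.ofReal (4 * b₂ * τ) := by
  have hsb : s * b₁ < s * b₂ := by gcongr
  have hsub : nearInteger b₁ b₂ τ s ⊆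
      ⋃ a ∈ Finset.Icc 1 ⌊s * b₂ + τ⌋, Set.Icc ((a - τ) / s) ((a + τ) / s) := by
    rintro α ⟨⟨h1, h2⟩, h3⟩
    obtain ⟨a, ha⟩ := Set.mem_iUnion.mp h3
    replace ha : |s * α - a| ≤ τ := ha
    rw [abs_le] at ha
    have h4 : s * b₁ < s * α := by gcongr
    have h5 : s * α < s * b₂ := by gcongr
    have ha0 : (0 : ℝ) < a := by linarith
    simp only [Set.mem_iUnion, Finset.mem_Icc, Set.mem_Icc]
    refine ⟨a, ⟨by exact_mod_cast ha0, by rw [Int.le_floor]; linarith⟩, ?_, ?_⟩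
    · rw [div_le_iff₀ hs]; linarith
    · rw [le_div_iff₀ hs]; linarith
  refine (measure_mono hsub).trans ?_
  rw [show 4 * b₂ * τ = (2 * s * b₂) * (2 * τ / s) by field_simp; ring]
  refine volume_biUnion_finset_le_ofReal _ _ (by positivity) ?_ fun a _ => ?_
  · rw [Int.card_Icc, ← Int.cast_natCast, Int.toNat_eq_max]
    push_cast
    have := Int.floor_le (s * b₂ + τ)
    exact max_le (by linarith) (by linarith)
  · rw [Real.volume_Icc]
    exact ENNReal.ofReal_le_ofReal (le_of_eq (by field_simp; ring))

/-- The number attached to a colouring `w` of the prime factors of `d` : the product of those primes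
whose colour is not `j`. -/
def primesAvoiding (d : ℕ) (j : Fin 3) (w : d.primeFactors → Fin 3) : ℕ :=
  ∏ p, if w p = j then 1 else (p : ℕ)

lemma primesAvoiding_pos (d : ℕ) (j : Fin 3) (w : d.primeFactors → Fin 3) :
    0 < primesAvoiding d j w :=
  Finset.prod_pos fun p _ => by
    split_ifs
    · exact one_pos
    · exact (Nat.prime_of_mem_primeFactors p.2).pos

lemma primesAvoiding_le {d : ℕ} (hd : Squarefree d) (j : Fin 3) (w : d.primeFactors → Fin 3) :
    primesAvoiding d j w ≤ d := by
  conv_rhs => rw [← Nat.prod_primeFactors_of_squarefree hd, ← Finset.prod_coe_sort]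
  refine Finset.prod_le_prod' fun p _ => ?_
  split_ifs
  · exact (Nat.prime_of_mem_primeFactors p.2).one_le
  · exact le_rfl

lemma natCast_prod_dvd_iff {ι : Type*} [Fintype ι] {f : ι → ℕ}
    (hf : Pairwise (Function.onFun Nat.Coprime f)) (n : ℤ) :
    ((∏ i, f i : ℕ) : ℤ) ∣ n ↔ ∀ i, (f i : ℤ) ∣ n := by
  constructor
  · intro h i
    exact (Int.natCast_dvd_natCast.mpr (Finset.dvd_prod_of_mem f (Finset.mem_univ i))).trans h
  · intro h
    push_cast
    refine Fintype.prod_dvd_of_coprime (fun i j hij => ?_) h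
    exact Nat.isCoprime_iff_coprime.mpr (hf hij)

lemma pairwise_coprime_primeFactors (d : ℕ) :
    Pairwise (Function.onFun Nat.Coprime fun p : d.primeFactors => (p : ℕ)) := fun p q hpq =>
  (Nat.coprime_primes (Nat.prime_of_mem_primeFactors p.2) (Nat.prime_of_mem_primeFactors q.2)).mpr
    fun h => hpq (Subtype.ext h)

lemma primesAvoiding_dvd_iff (d : ℕ) (j : Fin 3) (w : d.primeFactors → Fin 3) (n : ℤ) :
    (primesAvoiding d j w : ℤ) ∣ n ↔ ∀ p, w p ≠ j → ((p : ℕ) : ℤ) ∣ n := by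
  rw [primesAvoiding, natCast_prod_dvd_iff]
  · refine forall_congr' fun p => ?_
    split_ifs with h <;> simp [h]
  · intro p q hpq
    have := pairwise_coprime_primeFactors d hpq
    change Nat.Coprime (if w p = j then 1 else p) (if w q = j then 1 else q)
    split_ifs
    exacts [Nat.coprime_one_left 1, Nat.coprime_one_left q, Nat.coprime_one_right p, this]

/-- `1` or `-1` according to the parity of the number of primes with colour `2`. -/
def colourSign (d : ℕ) (w : d.primeFactors → Fin 3) : ℝ := ∏ p, if w p = 2 then -1 else 1

lemma abs_colourSign (d : ℕ) (w : d.primeFactors → Fin 3) : |colourSign d w| = 1 := by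
  rw [colourSign, Finset.abs_prod]
  exact Finset.prod_eq_one fun p _ => by split_ifs <;> simp

/-- Inclusion-exclusion over the prime factors `p` of `d`, for the alternatives `p ∣ n` (colour `0`),
`p ∣ m` (colour `1`), and both (colour `2`). -/
lemma ite_dvd_mul_eq_sum {d : ℕ} (hd : Squarefree d) (n m : ℤ) :
    (if (d : ℤ) ∣ n * m then (1 : ℝ) else 0) = ∑ w, colourSign d w *
      if (primesAvoiding d 1 w : ℤ) ∣ n ∧ (primesAvoiding d 0 w : ℤ) ∣ m then 1 else 0 := by
  have hdvd : (d : ℤ) ∣ n * m ↔ ∀ p : d.primeFactors, ((p : ℕ) : ℤ) ∣ n * m := by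
    conv_lhs => rw [← Nat.prod_primeFactors_of_squarefree hd, ← Finset.prod_coe_sort]
    exact natCast_prod_dvd_iff (pairwise_coprime_primeFactors d) _
  have hfactor (p : d.primeFactors) : (if ((p : ℕ) : ℤ) ∣ n * m then (1 : ℝ) else 0) =
      ∑ j : Fin 3, (if j = 2 then -1 else 1) *
        if (j ≠ 1 → ((p : ℕ) : ℤ) ∣ n) ∧ (j ≠ 0 → ((p : ℕ) : ℤ) ∣ m) then 1 else 0 := by
    have hp : Prime ((p : ℕ) : ℤ) :=
      Nat.prime_iff_prime_int.mp (Nat.prime_of_mem_primeFactors p.2)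
    simp only [Fin.sum_univ_three, hp.dvd_mul]
    by_cases h1 : ((p : ℕ) : ℤ) ∣ n <;> by_cases h2 : ((p : ℕ) : ℤ) ∣ m <;> simp [h1, h2]
  simp_rw [hdvd, ← Fintype.prod_boole, hfactor, Fintype.prod_sum]
  refine Finset.sum_congr rfl fun w _ => ?_
  rw [Finset.prod_mul_distrib, Fintype.prod_boole, colourSign]
  simp_rw [primesAvoiding_dvd_iff, forall_and]

lemma sum_colourSign_div {d : ℕ} (hd : Squarefree d) :
    ∑ w, colourSign d w / (primesAvoiding d 1 w * primesAvoiding d 0 w) =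
      1 / d * ∏ p ∈ d.primeFactors, (2 - 1 / (p : ℝ)) := by
  have hrhs : (1 : ℝ) / d * ∏ p ∈ d.primeFactors, (2 - 1 / (p : ℝ)) =
      ∏ p : d.primeFactors, ∑ j : Fin 3, (if j = 2 then (-1 : ℝ) else 1) /
        ((if j = 1 then 1 else (p : ℕ)) * (if j = 0 then 1 else (p : ℕ))) := by
    have hdprod : (d : ℝ) = ∏ p ∈ d.primeFactors, (p : ℝ) := by
      rw [← Nat.cast_prod, Nat.prod_primeFactors_of_squarefree hd]
    rw [hdprod, one_div, ← Finset.prod_inv_distrib, ← Finset.prod_mul_distrib,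
      ← Finset.prod_coe_sort]
    refine Finset.prod_congr rfl fun p _ => ?_
    have hp : ((p : ℕ) : ℝ) ≠ 0 := by exact_mod_cast (Nat.prime_of_mem_primeFactors p.2).ne_zero
    rw [Fin.sum_univ_three]
    simp
    field_simp
    ring
  rw [hrhs, Fintype.prod_sum]
  refine Finset.sum_congr rfl fun w _ => ?_
  rw [Finset.prod_div_distrib, Finset.prod_mul_distrib, colourSign, primesAvoiding, primesAvoiding]
  push_cast
  rfl

lemma exists_three_pow_card_primeFactors_le {η : ℝ} (hη : 0 < η) :
    ∃ C : ℝ, ∀ d : ℕ, d ≠ 0 → (3 : ℝ) ^ d.primeFactors.card ≤ C * (d : ℝ) ^ η := by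
  set P : ℕ := ⌈(3 : ℝ) ^ (1 / η)⌉₊ with hP
  refine ⟨3 ^ P, fun d hd => ?_⟩
  have hlarge : ∀ p : ℕ, P ≤ p → (3 : ℝ) ≤ (p : ℝ) ^ η := by
    intro p hp
    have h1 : (3 : ℝ) ^ (1 / η) ≤ p := (Nat.le_ceil _).trans (by exact_mod_cast hp)
    calc (3 : ℝ) = ((3 : ℝ) ^ (1 / η)) ^ η := by
          rw [← Real.rpow_mul (by norm_num), one_div_mul_cancel hη.ne', Real.rpow_one]
      _ ≤ (p : ℝ) ^ η := by gcongr
  have hsplit := Finset.card_filter_add_card_filter_not (s := d.primeFactors) (fun p => p < P)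
  have hsmall : (d.primeFactors.filter fun p => p < P).card ≤ P := by
    calc _ ≤ (Finset.range P).card := Finset.card_le_card fun p hp => by
          simpa using (Finset.mem_filter.mp hp).2
      _ = P := Finset.card_range P
  rw [← hsplit, pow_add]
  refine mul_le_mul (pow_le_pow_right₀ (by norm_num) hsmall) ?_ (by positivity) (by positivity)
  calc (3 : ℝ) ^ (d.primeFactors.filter fun p => ¬ p < P).card
      = ∏ _p ∈ d.primeFactors.filter fun p => ¬ p < P, (3 : ℝ) := by rw [Finset.prod_const]
    _ ≤ ∏ p ∈ d.primeFactors.filter fun p => ¬ p < P, (p : ℝ) ^ η :=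
        Finset.prod_le_prod (fun _ _ => by norm_num) fun p hp =>
          hlarge p (not_lt.mp (Finset.mem_filter.mp hp).2)
    _ = ((∏ p ∈ d.primeFactors.filter fun p => ¬ p < P, p : ℕ) : ℝ) ^ η := by
        rw [Nat.cast_prod, Real.finsetProd_rpow _ _ fun _ _ => by positivity]
    _ ≤ (d : ℝ) ^ η := by
        gcongr
        refine Nat.le_of_dvd (Nat.pos_of_ne_zero hd) ?_
        exact (Finset.prod_dvd_prod_of_subset _ _ _ (Finset.filter_subset _ _)).trans
          (Nat.prod_primeFactors_dvd d)

lemma ncard_dvd_mul_floor_eq_sum {d : ℕ} (hd : Squarefree d) (α β : ℝ) (x : ℕ) :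
    ({n : ℕ | 1 ≤ n ∧ n ≤ x ∧ (d : ℤ) ∣ (n : ℤ) * ⌊α * n + β⌋}.ncard : ℝ) =
      ∑ w, colourSign d w * (((Finset.Icc 1 x).filter fun n : ℕ =>
        (primesAvoiding d 1 w : ℤ) ∣ n ∧
          (primesAvoiding d 0 w : ℤ) ∣ ⌊α * n + β⌋).card : ℕ) := by
  have hset : {n : ℕ | 1 ≤ n ∧ n ≤ x ∧ (d : ℤ) ∣ (n : ℤ) * ⌊α * n + β⌋} =
      ((Finset.Icc 1 x).filter fun n : ℕ => (d : ℤ) ∣ (n : ℤ) * ⌊α * n + β⌋ : Finset ℕ) := by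
    ext n
    simp [and_assoc]
  rw [hset, Set.ncard_coe_finset, Finset.card_filter]
  push_cast
  simp_rw [ite_dvd_mul_eq_sum hd]
  rw [Finset.sum_comm]
  refine Finset.sum_congr rfl fun w _ => ?_
  rw [← Finset.mul_sum, Finset.card_filter]
  push_cast
  rfl

/-- The points of `(b₁, b₂)` whose dilates attached to the squarefree `d ≤ D` lie within `1 / T` of
a fraction with denominator at most `Q`, after scaling by that denominator. -/
def exceptionalSet (b₁ b₂ D Q T : ℝ) : Set ℝ :=
  ⋃ d ∈ (Finset.Icc 1 ⌊D⌋₊).filter Squarefree, ⋃ w ∈ Finset.univ, ⋃ q ∈ Finset.Icc 1 ⌊Q⌋₊,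
    nearInteger b₁ b₂ (1 / T) (q * primesAvoiding d 1 w / primesAvoiding d 0 w)

lemma measurableSet_exceptionalSet (b₁ b₂ D Q T : ℝ) :
    MeasurableSet (exceptionalSet b₁ b₂ D Q T) :=
  Finset.measurableSet_biUnion _ fun _ _ => Finset.measurableSet_biUnion _ fun _ _ =>
    Finset.measurableSet_biUnion _ fun _ _ => measurableSet_nearInteger _ _ _ _

lemma exceptionalSet_subset (b₁ b₂ D Q T : ℝ) : exceptionalSet b₁ b₂ D Q T ⊆ Set.Ioo b₁ b₂ :=
  Set.iUnion₂_subset fun _ _ => Set.iUnion₂_subset fun _ _ => Set.iUnion₂_subset fun _ _ =>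
    Set.inter_subset_left

lemma volume_exceptionalSet_le {b₁ b₂ D Q T W : ℝ} (hb₁ : 0 < b₁) (hb : b₁ < b₂) (hD : 0 ≤ D)
    (hQ : 0 ≤ Q) (hT : 0 < T) (hDT : D < b₁ * T) (hW : 0 ≤ W)
    (h3 : ∀ d : ℕ, d ≠ 0 → (d : ℝ) ≤ D → (3 : ℝ) ^ d.primeFactors.card ≤ W) :
    volume (exceptionalSet b₁ b₂ D Q T) ≤
      ENNReal.ofReal (D * (W * (Q * (4 * b₂ * (1 / T))))) := by
  have hb₂ : 0 < b₂ := hb₁.trans hb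
  refine volume_biUnion_finset_le_ofReal _ _ (by positivity) ?_ fun d hd => ?_
  · have h1 := Finset.card_filter_le (Finset.Icc 1 ⌊D⌋₊) Squarefree
    rw [Nat.card_Icc, Nat.add_sub_cancel] at h1
    exact (Nat.cast_le.mpr h1).trans (Nat.floor_le hD)
  rw [Finset.mem_filter, Finset.mem_Icc] at hd
  obtain ⟨⟨hd1, hdD⟩, hdsq⟩ := hd
  have hdD' : (d : ℝ) ≤ D := (Nat.le_floor_iff hD).mp hdD
  refine volume_biUnion_finset_le_ofReal _ _ (by positivity) ?_ fun w _ => ?_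
  · simpa using h3 d (by omega) hdD'
  refine volume_biUnion_finset_le_ofReal _ _ (by positivity) ?_ fun q hq => ?_
  · rw [Nat.card_Icc, Nat.add_sub_cancel]
    exact Nat.floor_le hQ
  rw [Finset.mem_Icc] at hq
  have hq1 : (1 : ℝ) ≤ q := by exact_mod_cast hq.1
  have hu : (1 : ℝ) ≤ primesAvoiding d 1 w := by exact_mod_cast primesAvoiding_pos d 1 w
  have hv : (0 : ℝ) < primesAvoiding d 0 w := by exact_mod_cast primesAvoiding_pos d 0 w
  have hvD : (primesAvoiding d 0 w : ℝ) ≤ D :=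
    (Nat.cast_le.mpr (primesAvoiding_le hdsq 0 w)).trans hdD'
  refine volume_nearInteger_le hb (by positivity) (by positivity) ?_
  calc 1 / T < b₁ / primesAvoiding d 0 w := by
        rw [div_lt_div_iff₀ hT hv]
        linarith
    _ = 1 * 1 / primesAvoiding d 0 w * b₁ := by ring
    _ ≤ q * primesAvoiding d 1 w / primesAvoiding d 0 w * b₁ := by gcongr

lemma abs_ncard_dvd_mul_floor_sub_le {b₁ b₂ D Q T α : ℝ} (β : ℝ) {d x : ℕ} (hd : Squarefree d)
    (hdD : (d : ℝ) ≤ D) (hT : 1 ≤ T) (hx : x ≤ Q * T)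
    (hα : α ∈ Set.Ioo b₁ b₂ \ exceptionalSet b₁ b₂ D Q T) :
    |({n : ℕ | 1 ≤ n ∧ n ≤ x ∧ (d : ℤ) ∣ (n : ℤ) * ⌊α * n + β⌋}.ncard : ℝ) -
      (x : ℝ) / d * ∏ p ∈ d.primeFactors, (2 - 1 / (p : ℝ))| ≤
        3 ^ d.primeFactors.card * (8 * T) := by
  have hmain : (x : ℝ) / d * ∏ p ∈ d.primeFactors, (2 - 1 / (p : ℝ)) =
      ∑ w, colourSign d w * (x / (primesAvoiding d 1 w * primesAvoiding d 0 w)) := by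
    rw [div_eq_mul_one_div, mul_assoc, ← sum_colourSign_div hd, Finset.mul_sum]
    exact Finset.sum_congr rfl fun w _ => by ring
  rw [ncard_dvd_mul_floor_eq_sum hd, hmain, ← Finset.sum_sub_distrib]
  have hcard : (3 : ℝ) ^ d.primeFactors.card * (8 * T) =
      ∑ _w : d.primeFactors → Fin 3, 8 * T := by
    simp
  rw [hcard]
  refine (Finset.abs_sum_le_sum_abs _ _).trans (Finset.sum_le_sum fun w _ => ?_)
  rw [← mul_sub, abs_mul, abs_colourSign, one_mul]
  refine abs_card_dvd_dvd_floor_sub_le (primesAvoiding_pos d 1 w) (primesAvoiding_pos d 0 w) β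
    hT hx fun q hq0 hqQ a => ?_
  by_contra! h
  refine hα.2 ?_
  simp only [exceptionalSet, Set.mem_iUnion]
  refine ⟨d, ?_, w, Finset.mem_univ w, q, ?_, hα.1, Set.mem_iUnion.mpr ⟨a, h⟩⟩
  · exact Finset.mem_filter.mpr ⟨Finset.mem_Icc.mpr ⟨Nat.pos_of_ne_zero hd.ne_zero,
      Nat.le_floor hdD⟩, hd⟩
  · exact Finset.mem_Icc.mpr ⟨hq0, Nat.le_floor hqQ⟩

theorem divisor_count_in_beatty_product :
    ∃ c₁ c₂ : ℝ, 0 < c₁ ∧ 0 < c₂ ∧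
      ∀ b₁ b₂ β ε : ℝ, 0 < b₁ → b₁ < b₂ → 0 < ε → ε < 1 / 12 →
        ∃ x₀ : ℕ, ∀ x : ℕ, x₀ ≤ x →
          ∃ J_E : Set ℝ, MeasurableSet J_E ∧ J_E ⊆ Set.Ioo b₁ b₂ ∧
            volume J_E ≤ ENNReal.ofReal (c₁ * (x : ℝ) ^ (-ε)) ∧
            ∀ d : ℕ, Squarefree d → (d : ℝ) ≤ (x : ℝ) ^ ((1 : ℝ) / 3 - 2 * ε) →
              ∀ α ∈ Set.Ioo b₁ b₂ \ J_E, Irrational α →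
                |({n : ℕ | 1 ≤ n ∧ n ≤ x ∧ (d : ℤ) ∣ (n : ℤ) * ⌊α * n + β⌋}.ncard : ℝ) -
                    (x : ℝ) / d * ∏ p ∈ d.primeFactors, (2 - 1 / (p : ℝ))| ≤
                  c₂ * (x : ℝ) ^ (1 - ε) / d := by
  refine ⟨1, 8, one_pos, by norm_num, fun b₁ b₂ β ε hb₁ hb hε _ => ?_⟩
  obtain ⟨C, hC⟩ := exists_three_pow_card_primeFactors_le (η := ε / 4) (by positivity)
  have hlim {y : ℝ} (hy : 0 < y) :
      Filter.Tendsto (fun x : ℕ => (x : ℝ) ^ y) Filter.atTop Filter.atTop :=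
    (tendsto_rpow_atTop hy).comp tendsto_natCast_atTop_atTop
  obtain ⟨x₀, hx₀⟩ := Filter.eventually_atTop.mp <|
    (Filter.eventually_ge_atTop 1).and <|
    ((hlim (y := ε / 4) (by positivity)).eventually_ge_atTop C).and <|
    ((hlim (y := ε / 2) (by positivity)).eventually_ge_atTop (4 * b₂)).and <|
    (hlim (y := 1 / 3) (by positivity)).eventually_gt_atTop (1 / b₁)
  refine ⟨x₀, fun x hx => ?_⟩
  obtain ⟨hx1, hxC, hxb₂, hxb₁⟩ := hx₀ x hx
  set X : ℝ := (x : ℝ)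
  have hX1 : 1 ≤ X := Nat.one_le_cast.mpr hx1
  have hX0 : 0 < X := by linarith
  have hDX : X ^ ((1 : ℝ) / 3 - 2 * ε) ≤ X ^ ((1 : ℝ) / 3) :=
    Real.rpow_le_rpow_of_exponent_le hX1 (by linarith)
  have h3 : ∀ d : ℕ, d ≠ 0 → (d : ℝ) ≤ X ^ ((1 : ℝ) / 3 - 2 * ε) →
      (3 : ℝ) ^ d.primeFactors.card ≤ X ^ (ε / 2) := by
    intro d hd hdD
    have hdX : (d : ℝ) ≤ X := by
      refine (hdD.trans hDX).trans ?_
      conv_rhs => rw [← Real.rpow_one X]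
      exact Real.rpow_le_rpow_of_exponent_le hX1 (by norm_num)
    calc (3 : ℝ) ^ d.primeFactors.card ≤ C * (d : ℝ) ^ (ε / 4) := hC d hd
      _ ≤ X ^ (ε / 4) * X ^ (ε / 4) := by gcongr
      _ = X ^ (ε / 2) := by rw [← Real.rpow_add hX0]; ring_nf
  have hT : 1 ≤ X ^ ((2 : ℝ) / 3) := Real.one_le_rpow hX1 (by norm_num)
  have hQ : 0 < X ^ ((1 : ℝ) / 3) := by positivity
  have hQT : X ^ ((2 : ℝ) / 3) = X ^ ((1 : ℝ) / 3) * X ^ ((1 : ℝ) / 3) := by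
    rw [← Real.rpow_add hX0]; norm_num
  refine ⟨exceptionalSet b₁ b₂ (X ^ ((1 : ℝ) / 3 - 2 * ε)) (X ^ ((1 : ℝ) / 3))
    (X ^ ((2 : ℝ) / 3)), measurableSet_exceptionalSet _ _ _ _ _, exceptionalSet_subset _ _ _ _ _,
    ?_, fun d hd hdD α hα _ => ?_⟩
  · refine (volume_exceptionalSet_le hb₁ hb (by positivity) hQ.le (by positivity) ?_
      (by positivity) h3).trans (ENNReal.ofReal_le_ofReal ?_)
    · rw [div_lt_iff₀ hb₁] at hxb₁
      rw [hQT]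
      nlinarith
    · calc X ^ ((1 : ℝ) / 3 - 2 * ε) * (X ^ (ε / 2) * (X ^ ((1 : ℝ) / 3) *
            (4 * b₂ * (1 / X ^ ((2 : ℝ) / 3)))))
          ≤ X ^ ((1 : ℝ) / 3 - 2 * ε) * (X ^ (ε / 2) * (X ^ ((1 : ℝ) / 3) *
            (X ^ (ε / 2) * X ^ (-((2 : ℝ) / 3))))) := by
            rw [Real.rpow_neg hX0.le, one_div (X ^ _)]
            gcongr
        _ = 1 * X ^ (-ε) := by
            simp only [← Real.rpow_add hX0]
            ring_nf
  · have hd0 : (0 : ℝ) < d := by exact_mod_cast Nat.pos_of_ne_zero hd.ne_zero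
    refine (abs_ncard_dvd_mul_floor_sub_le β hd hdD hT ?_ hα).trans ?_
    · rw [← Real.rpow_add hX0]
      norm_num
      exact le_rfl
    rw [le_div_iff₀ hd0]
    calc (3 : ℝ) ^ d.primeFactors.card * (8 * X ^ ((2 : ℝ) / 3)) * d
        ≤ X ^ (ε / 2) * (8 * X ^ ((2 : ℝ) / 3)) * X ^ ((1 : ℝ) / 3 - 2 * ε) := by
          gcongr
          exact h3 d hd.ne_zero hdD
      _ = 8 * (X ^ (ε / 2) * X ^ ((2 : ℝ) / 3) * X ^ ((1 : ℝ) / 3 - 2 * ε)) := by ring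
      _ ≤ 8 * X ^ (1 - ε) := by
          simp only [← Real.rpow_add hX0]
          gcongr
          linarith
end
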